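/- For all r > 0 and ρ > 0, the Lebesgue volume of the parallel body Ω_{r,ρ} = Ω_r + B̄(0,ρ) equals (2/3)[2E(√3/2) + K(√3/2)]·r³ + 4π·r²ρ + M₁·rρ² + (4π/3)·ρ³, where M₁ = 3K(√3/2) + 3π²/2 − 4I. -/

import Mathlib

open MeasureTheory Real Pointwise

noncomputable section

/-- The circle `k_A = {(x,y,z) : x² + (y+1/2)² = 1 ∧ z = 0}`. -/
def kA : Set (EuclideanSpace ℝ (Fin 3)) :=
  {p | p 0 ^ 2 + (p 1 + 1/2) ^ 2 = 1 ∧ p 2 = 0}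

/-- The circle `k_B = {(x,y,z) : (y−1/2)² + z² = 1 ∧ x = 0}`. -/
def kB : Set (EuclideanSpace ℝ (Fin 3)) :=
  {p | (p 1 - 1/2) ^ 2 + p 2 ^ 2 = 1 ∧ p 0 = 0}

/-- The oloid `Ω₁`: the convex hull of `k_A ∪ k_B`. -/
def oloid : Set (EuclideanSpace ℝ (Fin 3)) := convexHull ℝ (kA ∪ kB)

/-- The scaled oloid `Ω_r = r • Ω₁`. -/
def oloidR (r : ℝ) : Set (EuclideanSpace ℝ (Fin 3)) := r • oloid

/-- Complete elliptic integral of the first kind `K(k)`. -/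
def ellipticK (k : ℝ) : ℝ := ∫ x in (0:ℝ)..(π/2), 1 / Real.sqrt (1 - k^2 * Real.sin x ^ 2)

/-- Complete elliptic integral of the second kind `E(k)`. -/
def ellipticE (k : ℝ) : ℝ := ∫ x in (0:ℝ)..(π/2), Real.sqrt (1 - k^2 * Real.sin x ^ 2)

/-- The constant `I = ∫₀^{π/2} arccos(cos x/(1+cos x)) dx`. -/
def constI : ℝ := ∫ x in (0:ℝ)..(π/2), Real.arccos (Real.cos x / (1 + Real.cos x))

/-- Support function `h_C(u) = sup {⟨x,u⟩ : x ∈ C}` of a set `C ⊆ ℝ³`. -/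
def suppFn (C : Set (EuclideanSpace ℝ (Fin 3))) (u : EuclideanSpace ℝ (Fin 3)) : ℝ :=
  sSup ((fun x => (inner ℝ x u : ℝ)) '' C)

/-- Mean width of `C`: `(1/(4π)) ∫_{S²} (h_C(u) + h_C(−u)) dσ(u)`, where `σ` is the
2-dimensional Hausdorff measure on the unit sphere. (For `C = ∅` this gives `0`.) -/
def meanWidth (C : Set (EuclideanSpace ℝ (Fin 3))) : ℝ :=
  (1 / (4 * π)) *
    ∫ u in Metric.sphere (0 : EuclideanSpace ℝ (Fin 3)) 1, (suppFn C u + suppFn C (-u)) ∂μH[2]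

/-- The rotation group `SO(3)` as 3×3 real orthogonal matrices of determinant 1. -/
abbrev SO3 := Matrix.specialOrthogonalGroup (Fin 3) ℝ

instance : MeasurableSpace SO3 := borel SO3

instance : BorelSpace SO3 := ⟨rfl⟩

/-- The action of a rotation `θ ∈ SO(3)` on a point of `ℝ³`. -/
def rotate (θ : SO3) (p : EuclideanSpace ℝ (Fin 3)) : EuclideanSpace ℝ (Fin 3) :=
  (EuclideanSpace.equiv (Fin 3) ℝ).symm (Matrix.mulVec θ.1 (EuclideanSpace.equiv (Fin 3) ℝ p))

/-- `θ·S + x`: the image of `S` under the rotation `θ` followed by translation by `x`. -/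
def moveSet (θ : SO3) (x : EuclideanSpace ℝ (Fin 3)) (S : Set (EuclideanSpace ℝ (Fin 3))) :
    Set (EuclideanSpace ℝ (Fin 3)) :=
  (fun p => rotate θ p + x) '' S

/-- The ambient Euclidean space. -/
abbrev Space3 := EuclideanSpace ℝ (Fin 3)

/-- The disc bounded by `kA`. -/
def discA : Set Space3 := {p | p 0 ^ 2 + (p 1 + 1/2) ^ 2 ≤ 1 ∧ p 2 = 0}

/-- The disc bounded by `kB`. -/
def discB : Set Space3 := {p | (p 1 - 1/2) ^ 2 + p 2 ^ 2 ≤ 1 ∧ p 0 = 0}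

lemma inner_space3 (p u : Space3) : (inner ℝ p u : ℝ) = p 0 * u 0 + p 1 * u 1 + p 2 * u 2 := by
  simp [PiLp.inner_apply, Fin.sum_univ_three, mul_comm]

lemma space3_ext {p q : Space3} (h0 : p 0 = q 0) (h1 : p 1 = q 1) (h2 : p 2 = q 2) : p = q := by
  ext i; fin_cases i <;> assumption

lemma convex_sq_add_sq_le {x y x' y' a b : ℝ} (h : x ^ 2 + y ^ 2 ≤ 1) (h' : x' ^ 2 + y' ^ 2 ≤ 1)
    (ha : 0 ≤ a) (hb : 0 ≤ b) (hab : a + b = 1) :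
    (a * x + b * x') ^ 2 + (a * y + b * y') ^ 2 ≤ 1 := by
  obtain rfl : b = 1 - a := by linarith
  nlinarith [mul_nonneg ha hb, mul_nonneg (mul_nonneg ha hb) (sq_nonneg (x - x')),
    mul_nonneg (mul_nonneg ha hb) (sq_nonneg (y - y'))]

lemma convexHull_kA : convexHull ℝ kA = discA := by
  apply subset_antisymm
  · refine convexHull_min (fun p hp => ⟨hp.1.le, hp.2⟩) ?_
    rintro p ⟨hp, hp2⟩ q ⟨hq, hq2⟩ a b ha hb hab
    refine ⟨?_, by simp [hp2, hq2]⟩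
    have := convex_sq_add_sq_le hp hq ha hb hab
    have e0 : (a • p + b • q) 0 = a * p 0 + b * q 0 := rfl
    have e1 : (a • p + b • q) 1 = a * p 1 + b * q 1 := rfl
    rw [e0, e1]
    convert this using 3
    linear_combination (-1/2) * hab
  · rintro p ⟨hp, hp2⟩
    set m := √(1 - (p 1 + 1/2) ^ 2) with hm
    have hm2 : m ^ 2 = 1 - (p 1 + 1/2) ^ 2 := Real.sq_sqrt (by nlinarith [sq_nonneg (p 0)])
    have hm0 : 0 ≤ m := Real.sqrt_nonneg _
    have hpm : |p 0| ≤ m := abs_le_of_sq_le_sq (by linarith) hm0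
    obtain ⟨h1, h2⟩ := abs_le.1 hpm
    have mem : ∀ e : ℝ, e ^ 2 = m ^ 2 → (!₂[e, p 1, 0] : Space3) ∈ convexHull ℝ kA := fun e he =>
      subset_convexHull ℝ _ (by simp [kA]; linarith)
    rcases hm0.eq_or_lt with h0 | hpos
    · convert mem 0 (by rw [← h0]) using 1
      refine space3_ext ?_ ?_ ?_ <;> simp [hp2]
      linarith
    · have := (convex_convexHull ℝ kA) (mem (-m) (by ring)) (mem m rfl)
        (a := (m - p 0) / (2 * m)) (b := (m + p 0) / (2 * m))
        (div_nonneg (by linarith) (by linarith)) (div_nonneg (by linarith) (by linarith))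
        (by field_simp; ring)
      convert this using 1
      refine space3_ext ?_ ?_ ?_ <;> simp [hp2] <;> field_simp <;> ring

/-- The isometry of space exchanging the two circles. -/
def swapAB : Space3 ≃ₗᵢ[ℝ] Space3 where
  toFun p := !₂[p 2, - p 1, p 0]
  invFun p := !₂[p 2, - p 1, p 0]
  map_add' p q := by apply space3_ext <;> simp; ring
  map_smul' c p := by apply space3_ext <;> simp
  left_inv p := by apply space3_ext <;> simp
  right_inv p := by apply space3_ext <;> simp
  norm_map' p := by
    simp [EuclideanSpace.norm_eq, Fin.sum_univ_three]; ring_nf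

lemma swapAB_apply (p : Space3) : swapAB p = !₂[p 2, - p 1, p 0] := rfl

lemma swapAB_swapAB (p : Space3) : swapAB (swapAB p) = p := swapAB.left_inv p

lemma swapAB_image_eq_preimage (s : Set Space3) : swapAB '' s = swapAB ⁻¹' s :=
  congrFun (Set.image_eq_preimage_of_inverse swapAB_swapAB swapAB_swapAB) s

lemma swapAB_image_kA : swapAB '' kA = kB := by
  rw [swapAB_image_eq_preimage]
  ext p
  simp only [kA, kB, Set.mem_preimage, Set.mem_ofPred_eq, swapAB_apply]
  simp
  intro _
  ring_nf

lemma swapAB_image_discA : swapAB '' discA = discB := by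
  rw [swapAB_image_eq_preimage]
  ext p
  simp only [discA, discB, Set.mem_preimage, Set.mem_ofPred_eq, swapAB_apply]
  simp
  intro _
  ring_nf

lemma convexHull_kB : convexHull ℝ kB = discB := by
  rw [← swapAB_image_kA, ← swapAB_image_discA, ← convexHull_kA]
  exact (swapAB.toLinearEquiv.toLinearMap.image_convexHull kA).symm

lemma swapAB_image_oloid : swapAB '' oloid = oloid := by
  have h := swapAB.toLinearEquiv.toLinearMap.image_convexHull (kA ∪ kB)
  have hB : swapAB '' kB = kA := by
    rw [← swapAB_image_kA, Set.image_image]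
    simp [swapAB_swapAB]
  have : swapAB '' (kA ∪ kB) = kA ∪ kB := by
    rw [Set.image_union, hB, swapAB_image_kA, Set.union_comm]
  refine h.trans ?_
  exact congrArg _ this

lemma swapAB_mem_oloid {p : Space3} : swapAB p ∈ oloid ↔ p ∈ oloid := by
  rw [← Set.mem_preimage, ← swapAB_image_eq_preimage, swapAB_image_oloid]

lemma kA_nonempty : kA.Nonempty := ⟨!₂[1, -1/2, 0], by norm_num, rfl⟩

lemma kB_nonempty : kB.Nonempty := swapAB_image_kA ▸ kA_nonempty.image _

lemma oloid_eq_image : oloid =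
    (fun q : ℝ × Space3 × Space3 => (1 - q.1) • q.2.1 + q.1 • q.2.2) ''
      (Set.Icc 0 1 ×ˢ discA ×ˢ discB) := by
  rw [oloid, convexHull_union kA_nonempty kB_nonempty, convexHull_kA, convexHull_kB]
  ext p
  simp only [mem_convexJoin, segment_eq_image, Set.mem_image, Set.mem_prod, Prod.exists]
  constructor
  · rintro ⟨a, ha, b, hb, s, hs, rfl⟩
    exact ⟨s, a, b, ⟨hs, ha, hb⟩, rfl⟩
  · rintro ⟨s, a, b, ⟨hs, ha, hb⟩, rfl⟩
    exact ⟨a, ha, b, hb, s, hs, rfl⟩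

lemma isCompact_discA : IsCompact discA := by
  refine Metric.isCompact_of_isClosed_isBounded ?_ ?_
  · exact (isClosed_le (f := fun p : Space3 => p 0 ^ 2 + (p 1 + 1/2) ^ 2) (by fun_prop)
      continuous_const).inter
      (isClosed_eq (f := fun p : Space3 => p 2) (by fun_prop) continuous_const)
  · refine (Metric.isBounded_closedBall (x := (0 : Space3)) (r := 2)).subset ?_
    rintro p ⟨hp, hp2⟩
    rw [mem_closedBall_zero_iff, EuclideanSpace.norm_eq]
    refine Real.sqrt_le_iff.2 ⟨by norm_num, ?_⟩
    simp [Fin.sum_univ_three, hp2]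
    nlinarith [sq_nonneg (p 1 - 1/2), sq_nonneg (p 0)]

lemma isCompact_discB : IsCompact discB :=
  swapAB_image_discA ▸ isCompact_discA.image swapAB.continuous

lemma isCompact_oloid : IsCompact oloid := by
  rw [oloid_eq_image]
  exact ((isCompact_Icc.prod (isCompact_discA.prod isCompact_discB)).image (by fun_prop))

lemma convex_oloid : Convex ℝ oloid := convex_convexHull ℝ _

/-- The length of the projection of `u` to the plane of `kA`. -/
def radA (u : Space3) : ℝ := √(u 0 ^ 2 + u 1 ^ 2)

/-- The length of the projection of `u` to the plane of `kB`. -/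
def radB (u : Space3) : ℝ := √(u 1 ^ 2 + u 2 ^ 2)

/-- The support function of the disc bounded by `kA`. -/
def suppA (u : Space3) : ℝ := radA u - u 1 / 2

/-- The support function of the disc bounded by `kB`. -/
def suppB (u : Space3) : ℝ := radB u + u 1 / 2

/-- The point of `kA` with outer normal `u`. -/
def ptA (u : Space3) : Space3 := !₂[u 0 / radA u, -1/2 + u 1 / radA u, 0]

/-- The point of `kB` with outer normal `u`. -/
def ptB (u : Space3) : Space3 := !₂[0, 1/2 + u 1 / radB u, u 2 / radB u]

lemma radA_nonneg (u : Space3) : 0 ≤ radA u := Real.sqrt_nonneg _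

lemma radB_nonneg (u : Space3) : 0 ≤ radB u := Real.sqrt_nonneg _

lemma radA_sq (u : Space3) : radA u ^ 2 = u 0 ^ 2 + u 1 ^ 2 := Real.sq_sqrt (by positivity)

lemma radB_sq (u : Space3) : radB u ^ 2 = u 1 ^ 2 + u 2 ^ 2 := Real.sq_sqrt (by positivity)

lemma radA_swapAB (u : Space3) : radA (swapAB u) = radB u := by
  simp [radA, radB, swapAB_apply, add_comm]

lemma suppA_swapAB (u : Space3) : suppA (swapAB u) = suppB u := by
  simp only [suppA, suppB, radA_swapAB]; simp [swapAB_apply]; ring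

lemma suppB_swapAB (u : Space3) : suppB (swapAB u) = suppA u := by
  rw [← suppA_swapAB, swapAB_swapAB]

lemma ptA_swapAB (u : Space3) : ptA (swapAB u) = swapAB (ptB u) := by
  rw [ptA, radA_swapAB]
  apply space3_ext <;> simp [ptB, swapAB_apply]
  ring

lemma inner_swapAB_left (p u : Space3) :
    (inner ℝ (swapAB p) u : ℝ) = inner ℝ p (swapAB u) := by
  simp [inner_space3, swapAB_apply]; ring

lemma continuous_suppA : Continuous suppA := by unfold suppA radA; fun_prop

lemma continuous_suppB : Continuous suppB := by unfold suppB radB; fun_prop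

lemma inner_le_suppA {p : Space3} (hp : p ∈ discA) (u : Space3) : (inner ℝ p u : ℝ) ≤ suppA u := by
  obtain ⟨h, h2⟩ := hp
  have h1 : p 0 * u 0 + (p 1 + 1/2) * u 1 ≤ radA u := by
    apply Real.le_sqrt_of_sq_le
    nlinarith [sq_nonneg (p 0 * u 1 - (p 1 + 1/2) * u 0), sq_nonneg (u 0), sq_nonneg (u 1)]
  rw [inner_space3, suppA, h2]
  linarith

lemma eq_ptA_of_inner_eq {p u : Space3} (hp : p ∈ discA) (hu : 0 < radA u)
    (h : suppA u ≤ inner ℝ p u) : p = ptA u := by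
  obtain ⟨h1, h2⟩ := hp
  rw [inner_space3, suppA, h2] at h
  have hr := radA_sq u
  have key : (p 0 * radA u - u 0) ^ 2 + ((p 1 + 1/2) * radA u - u 1) ^ 2 ≤ 0 := by
    nlinarith [mul_le_mul_of_nonneg_right h1 (sq_nonneg (radA u)), mul_le_mul_of_nonneg_left h hu.le]
  have k0 : p 0 * radA u - u 0 = 0 := by
    nlinarith [sq_nonneg (p 0 * radA u - u 0), sq_nonneg ((p 1 + 1/2) * radA u - u 1)]
  have k1 : (p 1 + 1/2) * radA u - u 1 = 0 := by
    nlinarith [sq_nonneg (p 0 * radA u - u 0), sq_nonneg ((p 1 + 1/2) * radA u - u 1)]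
  apply space3_ext <;> simp [ptA, h2] <;> field_simp <;> linarith

lemma ptA_mem_kA {u : Space3} (hu : 0 < radA u) : ptA u ∈ kA := by
  have hr := radA_sq u
  simp [ptA, kA]
  field_simp
  linarith

lemma inner_ptA {u : Space3} (hu : 0 < radA u) : (inner ℝ (ptA u) u : ℝ) = suppA u := by
  have hr := radA_sq u
  simp [inner_space3, ptA, suppA]
  field_simp
  linarith

lemma inner_le_suppB {p : Space3} (hp : p ∈ discB) (u : Space3) : (inner ℝ p u : ℝ) ≤ suppB u := by
  rw [← swapAB_image_discA] at hp
  obtain ⟨q, hq, rfl⟩ := hp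
  rw [inner_swapAB_left, ← suppA_swapAB]
  exact inner_le_suppA hq _

lemma eq_ptB_of_inner_eq {p u : Space3} (hp : p ∈ discB) (hu : 0 < radB u)
    (h : suppB u ≤ inner ℝ p u) : p = ptB u := by
  rw [← swapAB_image_discA] at hp
  obtain ⟨q, hq, rfl⟩ := hp
  rw [inner_swapAB_left, ← suppA_swapAB] at h
  rw [eq_ptA_of_inner_eq hq (by rwa [radA_swapAB]) h, ptA_swapAB, swapAB_swapAB]

lemma inner_ptB {u : Space3} (hu : 0 < radB u) : (inner ℝ (ptB u) u : ℝ) = suppB u := by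
  rw [← swapAB_swapAB (ptB u), inner_swapAB_left, ← ptA_swapAB, ← suppA_swapAB]
  exact inner_ptA (by rwa [radA_swapAB])

lemma ptB_mem_kB {u : Space3} (hu : 0 < radB u) : ptB u ∈ kB := by
  rw [← swapAB_image_kA, ← swapAB_swapAB (ptB u), ← ptA_swapAB]
  exact Set.mem_image_of_mem _ (ptA_mem_kA (by rwa [radA_swapAB]))

/-- The support function of the oloid. -/
def suppO (u : Space3) : ℝ := max (suppA u) (suppB u)

lemma suppO_swapAB (u : Space3) : suppO (swapAB u) = suppO u := by
  rw [suppO, suppO, suppA_swapAB, suppB_swapAB, max_comm]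

lemma continuous_suppO : Continuous suppO := continuous_suppA.max continuous_suppB

lemma radA_pos_of_le {u : Space3} (hu : u ≠ 0) (h : suppB u ≤ suppA u) : 0 < radA u := by
  refine (radA_nonneg u).lt_of_ne fun h0 => hu ?_
  have hA := radA_sq u
  have hB := radB_sq u
  rw [← h0] at hA
  have h0' : u 0 = 0 := by nlinarith [sq_nonneg (u 0), sq_nonneg (u 1)]
  have h1' : u 1 = 0 := by nlinarith [sq_nonneg (u 0), sq_nonneg (u 1)]
  rw [suppA, suppB, ← h0, h1'] at h
  have h3 : radB u = 0 := le_antisymm (by linarith) (radB_nonneg u)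
  rw [h3, h1'] at hB
  have h2' : u 2 = 0 := by nlinarith
  apply space3_ext <;> simpa

lemma radB_pos_of_le {u : Space3} (hu : u ≠ 0) (h : suppA u ≤ suppB u) : 0 < radB u := by
  rw [← radA_swapAB]
  refine radA_pos_of_le (by simpa using hu) ?_
  rwa [suppA_swapAB, suppB_swapAB]

lemma suppO_pos {u : Space3} (hu : u ≠ 0) : 0 < suppO u := by
  have a1 : |u 1| ≤ radA u := Real.abs_le_sqrt (by nlinarith [sq_nonneg (u 0)])
  have b1 : |u 1| ≤ radB u := Real.abs_le_sqrt (by nlinarith [sq_nonneg (u 2)])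
  have := abs_le.1 a1
  have := abs_le.1 b1
  rcases le_total (suppB u) (suppA u) with h | h
  · have := radA_pos_of_le hu h
    exact lt_max_of_lt_left (by rw [suppA]; linarith)
  · have := radB_pos_of_le hu h
    exact lt_max_of_lt_right (by rw [suppB]; linarith)

lemma inner_le_suppO {p : Space3} (hp : p ∈ oloid) (u : Space3) : (inner ℝ p u : ℝ) ≤ suppO u := by
  rw [oloid_eq_image] at hp
  obtain ⟨⟨s, a, b⟩, ⟨⟨hs0, hs1⟩, ha, hb⟩, rfl⟩ := hp
  simp only at hs0 hs1 ha hb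
  simp only [inner_add_left, real_inner_smul_left]
  have h1 : (inner ℝ a u : ℝ) ≤ suppO u := (inner_le_suppA ha u).trans (le_max_left _ _)
  have h2 : (inner ℝ b u : ℝ) ≤ suppO u := (inner_le_suppB hb u).trans (le_max_right _ _)
  nlinarith

lemma exists_inner_eq_suppO {u : Space3} (hu : u ≠ 0) :
    ∃ p ∈ oloid, (inner ℝ p u : ℝ) = suppO u := by
  rcases le_total (suppB u) (suppA u) with h | h
  · have := radA_pos_of_le hu h
    exact ⟨ptA u, subset_convexHull ℝ _ (Or.inl (ptA_mem_kA this)), by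
      rw [inner_ptA this, suppO, max_eq_left h]⟩
  · have := radB_pos_of_le hu h
    exact ⟨ptB u, subset_convexHull ℝ _ (Or.inr (ptB_mem_kB this)), by
      rw [inner_ptB this, suppO, max_eq_right h]⟩

/-- The faces of the oloid are points of the two circles or segments between them. -/
lemma exists_eq_of_suppO_le {p u : Space3} (hp : p ∈ oloid) (hu : u ≠ 0)
    (h : suppO u ≤ inner ℝ p u) :
    ∃ s ∈ Set.Icc (0:ℝ) 1, p = (1 - s) • ptA u + s • ptB u ∧
      (suppA u < suppB u → s = 1) ∧ (suppB u < suppA u → s = 0) := by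
  rw [oloid_eq_image] at hp
  obtain ⟨⟨s, a, b⟩, ⟨⟨hs0, hs1⟩, ha, hb⟩, rfl⟩ := hp
  simp only at hs0 hs1 ha hb h ⊢
  simp only [inner_add_left, real_inner_smul_left] at h
  have hA := inner_le_suppA ha u
  have hB := inner_le_suppB hb u
  rcases lt_trichotomy (suppA u) (suppB u) with hlt | heq | hgt
  · rw [suppO, max_eq_right hlt.le] at h
    have h1 : s = 1 := by
      by_contra hne
      have : 0 < 1 - s := sub_pos.2 (lt_of_le_of_ne hs1 hne)
      nlinarith
    subst h1
    refine ⟨1, by simp, ?_, fun _ => rfl, fun h' => absurd h' hlt.not_gt⟩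
    rw [eq_ptB_of_inner_eq hb (radB_pos_of_le hu hlt.le) (by linarith)]
    simp
  · rw [suppO, max_eq_left heq.ge] at h
    refine ⟨s, ⟨hs0, hs1⟩, ?_, fun h' => absurd heq h'.ne, fun h' => absurd heq h'.ne'⟩
    congr 1
    · rcases hs1.eq_or_lt with rfl | hs
      · simp
      · rw [eq_ptA_of_inner_eq ha (radA_pos_of_le hu heq.ge)]
        nlinarith
    · rcases hs0.eq_or_lt with rfl | hs
      · simp
      · rw [eq_ptB_of_inner_eq hb (radB_pos_of_le hu heq.le)]
        nlinarith
  · rw [suppO, max_eq_left hgt.le] at h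
    have h1 : s = 0 := by
      by_contra hne
      have : 0 < s := lt_of_le_of_ne hs0 (Ne.symm hne)
      nlinarith
    subst h1
    refine ⟨0, by simp, ?_, fun h' => absurd h' hgt.not_gt, fun _ => rfl⟩
    rw [eq_ptA_of_inner_eq ha (radA_pos_of_le hu hgt.le) (by linarith)]
    simp

lemma exists_normal_of_notMem {x : Space3} (hx : x ∉ oloid) :
    ∃ p ∈ oloid, x ≠ p ∧ suppO (x - p) ≤ inner ℝ p (x - p) ∧ ∀ w ∈ oloid, ‖x - p‖ ≤ ‖x - w‖ := by
  obtain ⟨p, hp, hmin⟩ := exists_norm_eq_iInf_of_complete_convex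
    (kA_nonempty.mono (Set.subset_union_left.trans (subset_convexHull ℝ (kA ∪ kB))))
    isCompact_oloid.isClosed.isComplete convex_oloid x
  have hne : x ≠ p := fun h => hx (h ▸ hp)
  refine ⟨p, hp, hne, ?_, fun w hw => ?_⟩
  · obtain ⟨w, hw, hwe⟩ := exists_inner_eq_suppO (sub_ne_zero.2 hne)
    have := (norm_eq_iInf_iff_real_inner_le_zero convex_oloid hp).1 hmin w hw
    rw [real_inner_comm, inner_sub_left] at this
    linarith
  · rw [hmin]
    exact ciInf_le (f := fun w : oloid => ‖x - (w : Space3)‖)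
      ⟨0, by rintro _ ⟨w, rfl⟩; exact norm_nonneg _⟩ ⟨w, hw⟩

lemma mem_oloid_of_forall_inner_le {x : Space3} (h : ∀ u, (inner ℝ x u : ℝ) ≤ suppO u) :
    x ∈ oloid := by
  by_contra hx
  obtain ⟨p, hp, hne, hsup, -⟩ := exists_normal_of_notMem hx
  have h1 := h (x - p)
  have h2 : 0 < (inner ℝ (x - p) (x - p) : ℝ) := real_inner_self_pos.2 (sub_ne_zero.2 hne)
  rw [inner_sub_left] at h2
  linarith

/-- `v` is an outer normal vector of the oloid at its point `p`. -/
def IsNormalAt (p v : Space3) : Prop := p ∈ oloid ∧ v ≠ 0 ∧ suppO v ≤ inner ℝ p v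

lemma IsNormalAt.inner_sub_nonneg {p v w : Space3} (h : IsNormalAt p v) (hw : w ∈ oloid) :
    0 ≤ (inner ℝ (p - w) v : ℝ) := by
  rw [inner_sub_left]
  linarith [h.2.2, inner_le_suppO hw v]

lemma IsNormalAt.eq_of_add_eq {p v q w : Space3} (h : IsNormalAt p v) (h' : IsNormalAt q w)
    (e : p + v = q + w) : p = q ∧ v = w := by
  have e' : p - q = w - v := by
    rw [sub_eq_sub_iff_add_eq_add, e, add_comm]
  have h1 := h.inner_sub_nonneg h'.1
  have h2 := h'.inner_sub_nonneg h.1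
  have h3 : (inner ℝ (p - q) (p - q) : ℝ) = inner ℝ (p - q) w - inner ℝ (p - q) v := by
    nth_rewrite 2 [e']
    rw [inner_sub_right]
  have h4 : (inner ℝ (q - p) w : ℝ) = - inner ℝ (p - q) w := by
    rw [← inner_neg_left, neg_sub]
  have h5 : (inner ℝ (p - q) (p - q) : ℝ) ≤ 0 := by linarith
  have h6 : p = q := sub_eq_zero.1 (real_inner_self_nonpos.1 h5)
  exact ⟨h6, by rw [h6] at e; exact add_left_cancel e⟩

lemma IsNormalAt.add_notMem {p v : Space3} (h : IsNormalAt p v) : p + v ∉ oloid := fun hm => by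
  have h1 := h.inner_sub_nonneg hm
  rw [sub_add_cancel_left, inner_neg_left] at h1
  have := real_inner_self_pos.2 h.2.1
  linarith

lemma IsNormalAt.swapAB {p v : Space3} (h : IsNormalAt p v) :
    IsNormalAt (swapAB p) (swapAB v) :=
  ⟨swapAB_mem_oloid.2 h.1, by simpa using h.2.1, by
    rw [suppO_swapAB, inner_swapAB_left, swapAB_swapAB]; exact h.2.2⟩

/-- The points outside the oloid, at distance at most `ρ`, whose normal satisfies `c`. -/
def shell (ρ : ℝ) (c : Space3 → Prop) : Set Space3 :=
  {x | ∃ p v, IsNormalAt p v ∧ ‖v‖ ≤ ρ ∧ c v ∧ p + v = x}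

lemma disjoint_shell {ρ : ℝ} {c c' : Space3 → Prop} (h : ∀ v, c v → ¬ c' v) :
    Disjoint (shell ρ c) (shell ρ c') := by
  rw [Set.disjoint_left]
  rintro _ ⟨p, v, hn, -, hc, rfl⟩ ⟨q, w, hn', -, hc', e⟩
  obtain ⟨-, rfl⟩ := hn'.eq_of_add_eq hn e
  exact h _ hc hc'

lemma disjoint_oloid_shell (ρ : ℝ) (c : Space3 → Prop) : Disjoint oloid (shell ρ c) := by
  rw [Set.disjoint_left]
  rintro x hx ⟨p, v, hn, -, -, rfl⟩
  exact hn.add_notMem hx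

lemma parallelBody_eq_union {ρ : ℝ} (hρ : 0 ≤ ρ) :
    oloid + Metric.closedBall (0 : Space3) ρ =
      oloid ∪ (shell ρ (fun v => suppB v < suppA v) ∪
        (shell ρ (fun v => suppA v < suppB v) ∪ shell ρ (fun v => suppA v = suppB v))) := by
  ext x
  constructor
  · intro hx
    obtain ⟨w, hw, y, hy, rfl⟩ := Set.mem_add.1 hx
    by_cases hm : w + y ∈ oloid
    · exact Or.inl hm
    obtain ⟨p, hp, hne, hsup, hmin⟩ := exists_normal_of_notMem hm
    have hn : IsNormalAt p (w + y - p) := ⟨hp, sub_ne_zero.2 hne, hsup⟩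
    have hd : ‖w + y - p‖ ≤ ρ := by
      refine (hmin w hw).trans ?_
      simpa using hy
    rcases lt_trichotomy (suppA (w + y - p)) (suppB (w + y - p)) with h | h | h
    · exact Or.inr (Or.inr (Or.inl ⟨p, _, hn, hd, h, by abel⟩))
    · exact Or.inr (Or.inr (Or.inr ⟨p, _, hn, hd, h, by abel⟩))
    · exact Or.inr (Or.inl ⟨p, _, hn, hd, h, by abel⟩)
  · have key : ∀ c, shell ρ c ⊆ oloid + Metric.closedBall (0 : Space3) ρ := by
      rintro c _ ⟨p, v, hn, hv, -, rfl⟩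
      exact Set.add_mem_add hn.1 (by simpa using hv)
    rintro (h | h | h | h)
    · have := Set.add_mem_add h (Metric.mem_closedBall_self (x := (0 : Space3)) hρ)
      rwa [add_zero] at this
    all_goals exact key _ h

lemma shell_lt_eq_image (ρ : ℝ) :
    shell ρ (fun v => suppA v < suppB v) = swapAB '' shell ρ (fun v => suppB v < suppA v) := by
  ext x
  constructor
  · rintro ⟨p, v, hn, hv, hc, rfl⟩
    refine ⟨swapAB (p + v), ⟨swapAB p, swapAB v, hn.swapAB, by simpa using hv, ?_, by simp⟩,
      swapAB_swapAB _⟩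
    beta_reduce; rwa [suppA_swapAB, suppB_swapAB]
  · rintro ⟨_, ⟨p, v, hn, hv, hc, rfl⟩, rfl⟩
    refine ⟨swapAB p, swapAB v, hn.swapAB, by simpa using hv, ?_, by simp⟩
    beta_reduce; rwa [suppA_swapAB, suppB_swapAB]

lemma radA_smul {d : ℝ} (hd : 0 ≤ d) (u : Space3) : radA (d • u) = d * radA u := by
  have : (d * u 0) ^ 2 + (d * u 1) ^ 2 = d ^ 2 * (u 0 ^ 2 + u 1 ^ 2) := by ring
  simp [radA, this, Real.sqrt_mul (sq_nonneg d), Real.sqrt_sq hd]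

lemma suppA_smul {d : ℝ} (hd : 0 ≤ d) (u : Space3) : suppA (d • u) = d * suppA u := by
  simp [suppA, radA_smul hd]; ring

lemma suppB_smul {d : ℝ} (hd : 0 ≤ d) (u : Space3) : suppB (d • u) = d * suppB u := by
  rw [← suppA_swapAB, map_smul, suppA_smul hd, suppA_swapAB]

lemma suppO_smul {d : ℝ} (hd : 0 ≤ d) (u : Space3) : suppO (d • u) = d * suppO u := by
  rw [suppO, suppO, suppA_smul hd, suppB_smul hd, mul_max_of_nonneg _ _ hd]

lemma isNormalAt_smul_iff {p u : Space3} {d : ℝ} (hd : 0 < d) :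
    IsNormalAt p (d • u) ↔ IsNormalAt p u := by
  simp only [IsNormalAt, suppO_smul hd.le, real_inner_smul_right, ne_eq, smul_eq_zero, hd.ne',
    false_or, mul_le_mul_iff_right₀ hd]

lemma isNormalAt_ptA {u : Space3} (hu : u ≠ 0) (h : suppB u ≤ suppA u) : IsNormalAt (ptA u) u := by
  have hr := radA_pos_of_le hu h
  refine ⟨subset_convexHull ℝ _ (Or.inl (ptA_mem_kA hr)), hu, ?_⟩
  rw [inner_ptA hr, suppO, max_eq_left h]

lemma isNormalAt_ptB {u : Space3} (hu : u ≠ 0) (h : suppA u ≤ suppB u) : IsNormalAt (ptB u) u := by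
  have hr := radB_pos_of_le hu h
  refine ⟨subset_convexHull ℝ _ (Or.inr (ptB_mem_kB hr)), hu, ?_⟩
  rw [inner_ptB hr, suppO, max_eq_right h]

lemma IsNormalAt.convexCombination {p q u : Space3} (hp : IsNormalAt p u) (hq : IsNormalAt q u)
    {s : ℝ} (hs : s ∈ Set.Icc (0:ℝ) 1) : IsNormalAt ((1 - s) • p + s • q) u := by
  refine ⟨convex_oloid hp.1 hq.1 (sub_nonneg.2 hs.2) hs.1 (by ring), hp.2.1, ?_⟩
  rw [inner_add_left, real_inner_smul_left, real_inner_smul_left]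
  have := hp.2.2
  have := hq.2.2
  nlinarith [hs.1, hs.2]

/-- A shell is the union of the segments of length `ρ` in the directions of the unit normals. -/
lemma mem_shell_iff {ρ : ℝ} {c : Space3 → Prop} (hc : ∀ d : ℝ, 0 < d → ∀ v, c (d • v) ↔ c v)
    {x : Space3} : x ∈ shell ρ c ↔
      ∃ p u d, IsNormalAt p u ∧ ‖u‖ = 1 ∧ d ∈ Set.Ioc 0 ρ ∧ c u ∧ p + d • u = x := by
  constructor
  · rintro ⟨p, v, hn, hv, hcv, rfl⟩
    have hpos : 0 < ‖v‖ := norm_pos_iff.2 hn.2.1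
    have e : v = ‖v‖ • (‖v‖⁻¹ • v) := by rw [smul_smul, mul_inv_cancel₀ hpos.ne', one_smul]
    refine ⟨p, ‖v‖⁻¹ • v, ‖v‖, ?_, norm_smul_inv_norm hn.2.1, ⟨hpos, hv⟩, ?_, by rw [← e]⟩
    · exact (isNormalAt_smul_iff (inv_pos.2 hpos)).2 hn
    · exact (hc _ (inv_pos.2 hpos) _).2 hcv
  · rintro ⟨p, u, d, hn, hu, hd, hcu, rfl⟩
    refine ⟨p, d • u, (isNormalAt_smul_iff hd.1).2 hn, ?_, (hc _ hd.1 _).2 hcu, rfl⟩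
    rw [norm_smul, hu, mul_one, Real.norm_of_nonneg hd.1.le]
    exact hd.2

lemma eq_of_smul_eq_smul_of_norm_eq_one {u w : Space3} {d e : ℝ} (hd : 0 < d) (he : 0 < e)
    (hu : ‖u‖ = 1) (hw : ‖w‖ = 1) (h : d • u = e • w) : d = e ∧ u = w := by
  have h1 := congrArg norm h
  rw [norm_smul, norm_smul, hu, hw, Real.norm_of_nonneg hd.le, Real.norm_of_nonneg he.le,
    mul_one, mul_one] at h1
  subst h1
  exact ⟨rfl, smul_right_injective _ hd.ne' h⟩

lemma norm_eq_one_iff_sq {u : Space3} : ‖u‖ = 1 ↔ u 0 ^ 2 + u 1 ^ 2 + u 2 ^ 2 = 1 := by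
  rw [EuclideanSpace.norm_eq, Real.sqrt_eq_one]
  simp [Fin.sum_univ_three]

lemma exists_cos_sin_eq {a b : ℝ} (h : a ^ 2 + b ^ 2 = 1) :
    ∃ x ∈ Set.Ioc (-π) π, cos x = a ∧ sin x = b := by
  have hn : ‖(⟨a, b⟩ : ℂ)‖ = 1 := by
    rw [Complex.norm_def, Real.sqrt_eq_one, Complex.normSq_mk]; linarith
  have h0 : (⟨a, b⟩ : ℂ) ≠ 0 := by
    intro h; simp [h] at hn
  refine ⟨Complex.arg ⟨a, b⟩, Complex.arg_mem_Ioc _, ?_, ?_⟩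
  · rw [Complex.cos_arg h0, hn, div_one]
  · rw [Complex.sin_arg, hn, div_one]

lemma eq_of_cos_eq_sin_eq {x y : ℝ} (hx : x ∈ Set.Ioc (-π) π) (hy : y ∈ Set.Ioc (-π) π)
    (hc : cos x = cos y) (hs : sin x = sin y) : x = y := by
  have h := Real.Angle.cos_sin_inj hc hs
  have h1 := congrArg Real.Angle.toReal h
  rwa [Real.Angle.toReal_coe_eq_self_iff.2 hx, Real.Angle.toReal_coe_eq_self_iff.2 hy] at h1

/-- The Jacobi delta amplitude function of modulus `√3/2`. -/
def delta (x : ℝ) : ℝ := √(1 - 3/4 * sin x ^ 2)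

lemma delta_sq_pos (x : ℝ) : 0 < 1 - 3/4 * sin x ^ 2 := by nlinarith [sin_sq_le_one x]

lemma delta_pos (x : ℝ) : 0 < delta x := Real.sqrt_pos.2 (delta_sq_pos x)

lemma delta_sq (x : ℝ) : delta x ^ 2 = 1 - 3/4 * sin x ^ 2 := Real.sq_sqrt (delta_sq_pos x).le

lemma sqrt_three_sq : √(3:ℝ) ^ 2 = 3 := Real.sq_sqrt (by norm_num)

lemma sqrt_three_pos : 0 < √(3:ℝ) := Real.sqrt_pos.2 (by norm_num)

/-- The unit normal of the oloid along a ruling. -/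
def ruleNormal (x : ℝ) : Space3 :=
  !₂[√3 * sin x / 2, (1 - 2 * delta x ^ 2) / (2 * delta x), √3 * cos x / (2 * delta x)]

/-- The end point on `kA` of a ruling. -/
def ruleA (x : ℝ) : Space3 := !₂[√3 * sin x * delta x, 1/2 - 2 * delta x ^ 2, 0]

/-- The end point on `kB` of a ruling. -/
def ruleB (x : ℝ) : Space3 :=
  !₂[0, 1 / (2 * delta x ^ 2) - 1/2, √3 * cos x / (2 * delta x ^ 2)]

lemma cos_sq_eq_delta (x : ℝ) : 3 * cos x ^ 2 = 4 * delta x ^ 2 - 1 := by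
  rw [delta_sq, cos_sq']; ring

lemma sin_sq_eq_delta (x : ℝ) : 3 * sin x ^ 2 = 4 - 4 * delta x ^ 2 := by
  rw [delta_sq]; ring

lemma radA_ruleNormal (x : ℝ) : radA (ruleNormal x) = 1 / (2 * delta x) := by
  have h := delta_pos x
  rw [radA, Real.sqrt_eq_iff_mul_self_eq_of_pos (by positivity)]
  simp [ruleNormal]
  field_simp
  rw [sqrt_three_sq]
  linear_combination (- delta x ^ 2) * sin_sq_eq_delta x

lemma radB_ruleNormal (x : ℝ) : radB (ruleNormal x) = delta x := by
  have h := delta_pos x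
  rw [radB, Real.sqrt_eq_iff_mul_self_eq_of_pos (by positivity)]
  simp [ruleNormal]
  field_simp
  rw [sqrt_three_sq]
  linear_combination (-1) * cos_sq_eq_delta x

lemma norm_ruleNormal (x : ℝ) : ‖ruleNormal x‖ = 1 := by
  have h := delta_pos x
  rw [norm_eq_one_iff_sq, add_assoc, ← radB_sq, radB_ruleNormal]
  simp [ruleNormal]
  field_simp
  rw [sqrt_three_sq]
  linear_combination sin_sq_eq_delta x

lemma ruleNormal_ne_zero (x : ℝ) : ruleNormal x ≠ 0 := by
  intro h
  have := norm_ruleNormal x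
  simp [h] at this

lemma suppA_ruleNormal (x : ℝ) : suppA (ruleNormal x) = (1 + 2 * delta x ^ 2) / (4 * delta x) := by
  have h := delta_pos x
  rw [suppA, radA_ruleNormal]
  simp [ruleNormal]
  field_simp
  ring

lemma suppB_ruleNormal (x : ℝ) : suppB (ruleNormal x) = (1 + 2 * delta x ^ 2) / (4 * delta x) := by
  have h := delta_pos x
  rw [suppB, radB_ruleNormal]
  simp [ruleNormal]
  field_simp
  ring

lemma suppO_ruleNormal (x : ℝ) : suppO (ruleNormal x) = (1 + 2 * delta x ^ 2) / (4 * delta x) := by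
  rw [suppO, suppA_ruleNormal, suppB_ruleNormal, max_self]

lemma ptA_ruleNormal (x : ℝ) : ptA (ruleNormal x) = ruleA x := by
  have h := delta_pos x
  rw [ptA, radA_ruleNormal]
  apply space3_ext <;> simp [ruleNormal, ruleA] <;> field_simp
  ring

lemma ptB_ruleNormal (x : ℝ) : ptB (ruleNormal x) = ruleB x := by
  have h := delta_pos x
  rw [ptB, radB_ruleNormal]
  apply space3_ext <;> simp [ruleNormal, ruleB] <;> field_simp
  ring

lemma exists_ruleNormal_eq {u : Space3} (hu : ‖u‖ = 1) (h : suppA u = suppB u) :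
    ∃ x ∈ Set.Ioc (-π) π, u = ruleNormal x := by
  have h0 : u ≠ 0 := by rintro rfl; simp at hu
  have hr := radA_pos_of_le h0 h.ge
  rw [norm_eq_one_iff_sq] at hu
  have hA := radA_sq u
  have hB := radB_sq u
  rw [suppA, suppB] at h
  have hB' : radB u = radA u - u 1 := by linarith
  have e1 : u 1 = radA u - 1 / (2 * radA u) := by
    field_simp
    rw [hB'] at hB
    linarith
  have e2 : u 2 ^ 2 = 1 - radA u ^ 2 := by linarith
  have e0 : u 0 ^ 2 = 1 - 1 / (4 * radA u ^ 2) := by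
    have : u 0 ^ 2 = radA u ^ 2 - u 1 ^ 2 := by linarith
    rw [this, e1]
    field_simp
    ring
  have h3 := sqrt_three_pos
  obtain ⟨x, hx, hc, hs⟩ := exists_cos_sin_eq (a := u 2 / (√3 * radA u)) (b := 2 * u 0 / √3) (by
    rw [div_pow, div_pow, mul_pow, mul_pow, sqrt_three_sq, e0, e2]
    field_simp
    ring)
  have hd : delta x = 1 / (2 * radA u) := by
    rw [delta, Real.sqrt_eq_iff_mul_self_eq_of_pos (by positivity), hs, div_pow, mul_pow,
      sqrt_three_sq, e0]
    field_simp
    ring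
  refine ⟨x, hx, ?_⟩
  apply space3_ext <;> simp only [ruleNormal, hd, hc, hs]
  · simp; field_simp
  · simp; rw [e1]; field_simp
  · simp; field_simp

lemma ruleNormal_injOn : Set.InjOn ruleNormal (Set.Ioc (-π) π) := by
  intro x hx y hy h
  have h0 : √3 * sin x / 2 = √3 * sin y / 2 := congrArg (fun u : Space3 => u 0) h
  have h2 : √3 * cos x / (2 * delta x) = √3 * cos y / (2 * delta y) :=
    congrArg (fun u : Space3 => u 2) h
  have h3 := sqrt_three_pos
  have hs : sin x = sin y := by
    have : √3 * sin x = √3 * sin y := by linarith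
    exact mul_left_cancel₀ h3.ne' this
  have hd : delta x = delta y := by rw [delta, delta, hs]
  rw [hd] at h2
  have := delta_pos y
  field_simp at h2
  exact eq_of_cos_eq_sin_eq hx hy h2 hs

lemma ruleA_ne_ruleB (x : ℝ) : ruleA x ≠ ruleB x := by
  intro h
  have h1 : 1/2 - 2 * delta x ^ 2 = 1 / (2 * delta x ^ 2) - 1/2 :=
    congrArg (fun u : Space3 => u 1) h
  have := delta_pos x
  field_simp at h1
  nlinarith [sq_nonneg (2 * delta x ^ 2 - 1), sq_nonneg (delta x)]

lemma isNormalAt_ruleA (x : ℝ) : IsNormalAt (ruleA x) (ruleNormal x) := by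
  rw [← ptA_ruleNormal]
  exact isNormalAt_ptA (ruleNormal_ne_zero x) (by rw [suppA_ruleNormal, suppB_ruleNormal])

lemma isNormalAt_ruleB (x : ℝ) : IsNormalAt (ruleB x) (ruleNormal x) := by
  rw [← ptB_ruleNormal]
  exact isNormalAt_ptB (ruleNormal_ne_zero x) (by rw [suppA_ruleNormal, suppB_ruleNormal])

/-- The point dividing a ruling in the ratio `s : 1 - s`. -/
def rulePt (x s : ℝ) : Space3 := (1 - s) • ruleA x + s • ruleB x

lemma isNormalAt_rulePt (x : ℝ) {s : ℝ} (hs : s ∈ Set.Icc (0:ℝ) 1) :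
    IsNormalAt (rulePt x s) (ruleNormal x) :=
  (isNormalAt_ruleA x).convexCombination (isNormalAt_ruleB x) hs

lemma rulePt_injective (x : ℝ) : Function.Injective (rulePt x) := by
  intro s t h
  have h' : (s - t) • (ruleB x - ruleA x) = 0 := by
    have : rulePt x s - rulePt x t = (s - t) • (ruleB x - ruleA x) := by
      rw [rulePt, rulePt]; module
    rw [← this, h, sub_self]
  rcases smul_eq_zero.1 h' with h | h
  · linarith
  · exact absurd (sub_eq_zero.1 h).symm (ruleA_ne_ruleB x)

/-- Parametrization of the exterior points whose nearest point lies on a ruling. -/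
def ruledExterior (q : ℝ × ℝ × ℝ) : Space3 := rulePt q.1 q.2.1 + q.2.2 • ruleNormal q.1

lemma shell_eq_ruledExterior_image (ρ : ℝ) :
    shell ρ (fun v => suppA v = suppB v) =
      ruledExterior '' (Set.Ioc (-π) π ×ˢ Set.Icc (0:ℝ) 1 ×ˢ Set.Ioc 0 ρ) := by
  ext y
  rw [mem_shell_iff (fun d hd v => by
    rw [suppA_smul hd.le, suppB_smul hd.le, mul_right_inj' hd.ne'])]
  constructor
  · rintro ⟨p, u, d, hn, hu, hd, hc, rfl⟩
    obtain ⟨x, hx, rfl⟩ := exists_ruleNormal_eq hu hc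
    obtain ⟨s, hs, hp, -, -⟩ := exists_eq_of_suppO_le hn.1 hn.2.1 hn.2.2
    rw [ptA_ruleNormal, ptB_ruleNormal] at hp
    exact ⟨(x, s, d), ⟨hx, hs, hd⟩, by rw [hp]; rfl⟩
  · rintro ⟨⟨x, s, d⟩, ⟨hx, hs, hd⟩, rfl⟩
    exact ⟨rulePt x s, ruleNormal x, d, isNormalAt_rulePt x hs, norm_ruleNormal x, hd,
      by rw [suppA_ruleNormal, suppB_ruleNormal], rfl⟩

lemma ruledExterior_injOn (ρ : ℝ) :
    Set.InjOn ruledExterior (Set.Ioc (-π) π ×ˢ Set.Icc (0:ℝ) 1 ×ˢ Set.Ioc 0 ρ) := by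
  rintro ⟨x, s, d⟩ ⟨hx, hs, hd⟩ ⟨y, t, e⟩ ⟨hy, ht, he⟩ h
  simp only at hx hs hd hy ht he
  have h1 := (isNormalAt_smul_iff hd.1).2 (isNormalAt_rulePt x hs)
  have h2 := (isNormalAt_smul_iff he.1).2 (isNormalAt_rulePt y ht)
  obtain ⟨e1, e2⟩ := h1.eq_of_add_eq h2 h
  obtain ⟨rfl, e3⟩ := eq_of_smul_eq_smul_of_norm_eq_one hd.1 he.1 (norm_ruleNormal x)
    (norm_ruleNormal y) e2
  obtain rfl := ruleNormal_injOn hx hy e3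
  obtain rfl := rulePt_injective x e1
  rfl

/-- Parametrization of the oloid by the segments from the origin to its rulings. -/
def ruledCone (q : ℝ × ℝ × ℝ) : Space3 := q.2.2 • rulePt q.1 q.2.1

lemma inner_rulePt (x s : ℝ) : (inner ℝ (rulePt x s) (ruleNormal x) : ℝ) = suppO (ruleNormal x) := by
  have hA : (inner ℝ (ruleA x) (ruleNormal x) : ℝ) = suppO (ruleNormal x) :=
    le_antisymm (inner_le_suppO (isNormalAt_ruleA x).1 _) (isNormalAt_ruleA x).2.2
  have hB : (inner ℝ (ruleB x) (ruleNormal x) : ℝ) = suppO (ruleNormal x) :=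
    le_antisymm (inner_le_suppO (isNormalAt_ruleB x).1 _) (isNormalAt_ruleB x).2.2
  rw [rulePt, inner_add_left, real_inner_smul_left, real_inner_smul_left, hA, hB]
  ring

lemma le_of_smul_rulePt_eq {x s y t l m : ℝ} (ht : t ∈ Set.Icc (0:ℝ) 1) (hm : 0 ≤ m)
    (h : l • rulePt x s = m • rulePt y t) : l ≤ m := by
  have hpos := suppO_pos (ruleNormal_ne_zero x)
  have h1 := congrArg (fun p => (inner ℝ p (ruleNormal x) : ℝ)) h
  simp only [real_inner_smul_left, inner_rulePt] at h1
  have h2 := inner_le_suppO (isNormalAt_rulePt y ht).1 (ruleNormal x)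
  nlinarith

lemma ruleA_ruleB_injOn {x y : ℝ} (hx : x ∈ Set.Ioc (-π) π) (hy : y ∈ Set.Ioc (-π) π)
    (hA : ruleA x = ruleA y) (hB : ruleB x = ruleB y) : x = y := by
  have h0 : √3 * sin x * delta x = √3 * sin y * delta y := congrArg (fun u : Space3 => u 0) hA
  have h1 : 1/2 - 2 * delta x ^ 2 = 1/2 - 2 * delta y ^ 2 := congrArg (fun u : Space3 => u 1) hA
  have h2 : √3 * cos x / (2 * delta x ^ 2) = √3 * cos y / (2 * delta y ^ 2) :=
    congrArg (fun u : Space3 => u 2) hB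
  have h3 := sqrt_three_pos
  have hdy := delta_pos y
  have hd : delta x = delta y :=
    (sq_eq_sq₀ (delta_pos x).le hdy.le).1 (by linarith)
  rw [hd] at h0 h2
  field_simp at h0 h2
  exact eq_of_cos_eq_sin_eq hx hy h2 h0

lemma ruledCone_injOn :
    Set.InjOn ruledCone (Set.Ioc (-π) π ×ˢ Set.Ioo (0:ℝ) 1 ×ˢ Set.Ioc (0:ℝ) 1) := by
  rintro ⟨x, s, l⟩ ⟨hx, hs, hl⟩ ⟨y, t, m⟩ ⟨hy, ht, hm⟩ h
  simp only at hx hs hl hy ht hm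
  have hs' := Set.Ioo_subset_Icc_self hs
  have ht' := Set.Ioo_subset_Icc_self ht
  obtain rfl : l = m :=
    le_antisymm (le_of_smul_rulePt_eq ht' hm.1.le h) (le_of_smul_rulePt_eq hs' hl.1.le h.symm)
  have e : rulePt x s = rulePt y t := smul_right_injective _ hl.1.ne' h
  have hr : radA (ruleNormal x) > 0 := by
    rw [radA_ruleNormal]; have := delta_pos x; positivity
  have hr' : radB (ruleNormal x) > 0 := by
    rw [radB_ruleNormal]; exact delta_pos x
  have hA : ruleA y ∈ discA := convexHull_kA ▸ subset_convexHull ℝ _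
    (ptA_ruleNormal y ▸ ptA_mem_kA (by rw [radA_ruleNormal]; have := delta_pos y; positivity))
  have hB : ruleB y ∈ discB := convexHull_kB ▸ subset_convexHull ℝ _
    (ptB_ruleNormal y ▸ ptB_mem_kB (by rw [radB_ruleNormal]; exact delta_pos y))
  have h1 := inner_rulePt x s
  rw [e, rulePt, inner_add_left, real_inner_smul_left, real_inner_smul_left] at h1
  have h2 := inner_le_suppA hA (ruleNormal x)
  have h3 := inner_le_suppB hB (ruleNormal x)
  have h4 : suppO (ruleNormal x) = suppA (ruleNormal x) := by
    rw [suppO_ruleNormal, suppA_ruleNormal]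
  have h5 : suppO (ruleNormal x) = suppB (ruleNormal x) := by
    rw [suppO_ruleNormal, suppB_ruleNormal]
  have eA : ruleA y = ruleA x := by
    rw [← ptA_ruleNormal x]
    exact eq_ptA_of_inner_eq hA hr (by nlinarith [ht.1, ht.2])
  have eB : ruleB y = ruleB x := by
    rw [← ptB_ruleNormal x]
    exact eq_ptB_of_inner_eq hB hr' (by nlinarith [ht.1, ht.2])
  obtain rfl := ruleA_ruleB_injOn hx hy eA.symm eB.symm
  obtain rfl := rulePt_injective x e
  rfl

lemma zero_mem_oloid : (0 : Space3) ∈ oloid :=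
  mem_oloid_of_forall_inner_le fun u => by
    rcases eq_or_ne u 0 with rfl | hu
    · simp [suppO, suppA, suppB, radA, radB]
    · rw [inner_zero_left]; exact (suppO_pos hu).le

lemma ruledCone_image_subset :
    ruledCone '' (Set.Ioc (-π) π ×ˢ Set.Ioo (0:ℝ) 1 ×ˢ Set.Ioc (0:ℝ) 1) ⊆ oloid := by
  rintro _ ⟨⟨x, s, l⟩, ⟨hx, hs, hl⟩, rfl⟩
  exact convex_oloid.smul_mem_of_zero_mem zero_mem_oloid
    (isNormalAt_rulePt x (Set.Ioo_subset_Icc_self hs)).1 ⟨hl.1.le, hl.2⟩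

lemma mem_ruledCone_image {p : Space3} (hp : p ∈ oloid) (h0 : p 0 ≠ 0) (h2 : p 2 ≠ 0) :
    p ∈ ruledCone '' (Set.Ioc (-π) π ×ˢ Set.Ioo (0:ℝ) 1 ×ˢ Set.Ioc (0:ℝ) 1) := by
  have hp0 : p ≠ 0 := by rintro rfl; simp at h0
  have hne : ∀ u ∈ Metric.sphere (0 : Space3) 1, u ≠ 0 := fun u hu =>
    ne_zero_of_mem_unit_sphere ⟨u, hu⟩
  have hcont : ContinuousOn (fun u : Space3 => (inner ℝ p u : ℝ) / suppO u)
      (Metric.sphere (0 : Space3) 1) :=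
    ContinuousOn.div (by fun_prop) continuous_suppO.continuousOn
      fun u hu => (suppO_pos (hne u hu)).ne'
  have hmem : ‖p‖⁻¹ • p ∈ Metric.sphere (0 : Space3) 1 := by
    rw [mem_sphere_zero_iff_norm]; exact norm_smul_inv_norm hp0
  obtain ⟨u, hu, hmax⟩ := (isCompact_sphere (0 : Space3) 1).exists_isMaxOn ⟨_, hmem⟩ hcont
  set l := (inner ℝ p u : ℝ) / suppO u with hl
  have hu0 := hne u hu
  have hsu := suppO_pos hu0
  have hlpos : 0 < l := by
    refine lt_of_lt_of_le ?_ (hmax hmem)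
    refine div_pos ?_ (suppO_pos (hne _ hmem))
    rw [real_inner_smul_right]
    have := real_inner_self_pos.2 hp0
    have := norm_pos_iff.2 hp0
    positivity
  have hl1 : l ≤ 1 := (div_le_one hsu).2 (inner_le_suppO hp u)
  have hq : l⁻¹ • p ∈ oloid := by
    refine mem_oloid_of_forall_inner_le fun v => ?_
    rcases eq_or_ne v 0 with rfl | hv
    · simp [suppO, suppA, suppB, radA, radB]
    have hvpos := norm_pos_iff.2 hv
    have hw : ‖v‖⁻¹ • v ∈ Metric.sphere (0 : Space3) 1 := by
      rw [mem_sphere_zero_iff_norm]; exact norm_smul_inv_norm hv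
    have h1 : (inner ℝ p (‖v‖⁻¹ • v) : ℝ) / suppO (‖v‖⁻¹ • v) ≤ l := hmax hw
    rw [suppO_smul (inv_pos.2 hvpos).le, real_inner_smul_right,
      mul_div_mul_left _ _ (inv_pos.2 hvpos).ne', div_le_iff₀ (suppO_pos hv)] at h1
    rw [real_inner_smul_left, inv_mul_le_iff₀ hlpos]
    exact h1
  have hface : suppO u ≤ inner ℝ (l⁻¹ • p) u := by
    rw [real_inner_smul_left, hl, inv_div, div_mul_cancel₀]
    intro h
    rw [hl, h, zero_div] at hlpos
    exact hlpos.false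
  obtain ⟨s, hs, e, hAB, hBA⟩ := exists_eq_of_suppO_le hq hu0 hface
  have c0 : l⁻¹ * p 0 = (1 - s) * ptA u 0 := by
    have := congrArg (fun w : Space3 => w 0) e
    simpa [ptB] using this
  have c2 : l⁻¹ * p 2 = s * ptB u 2 := by
    have := congrArg (fun w : Space3 => w 2) e
    simpa [ptA] using this
  have hs0 : s ≠ 0 := by
    rintro rfl
    have : l⁻¹ * p 2 ≠ 0 := mul_ne_zero (inv_pos.2 hlpos).ne' h2
    exact this (by rw [c2, zero_mul])
  have hs1 : s ≠ 1 := by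
    rintro rfl
    have : l⁻¹ * p 0 ≠ 0 := mul_ne_zero (inv_pos.2 hlpos).ne' h0
    exact this (by rw [c0, sub_self, zero_mul])
  have heq : suppA u = suppB u := by
    rcases lt_trichotomy (suppA u) (suppB u) with h | h | h
    · exact absurd (hAB h) hs1
    · exact h
    · exact absurd (hBA h) hs0
  obtain ⟨x, hx, rfl⟩ := exists_ruleNormal_eq (mem_sphere_zero_iff_norm.1 hu) heq
  rw [ptA_ruleNormal, ptB_ruleNormal] at e
  refine ⟨(x, s, l), ⟨hx, ⟨lt_of_le_of_ne hs.1 (Ne.symm hs0), lt_of_le_of_ne hs.2 hs1⟩,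
    hlpos, hl1⟩, ?_⟩
  change l • ((1 - s) • ruleA x + s • ruleB x) = p
  rw [← e, smul_smul, mul_inv_cancel₀ hlpos.ne', one_smul]

/-- The parameter on `kB` of the rulings through the points of `kA` with parameter `t`, which is
also twice the largest latitude of a normal there. -/
def dualParam (t : ℝ) : ℝ := arccos (-(cos t / (1 + cos t)))

/-- The unit vector of longitude `t` and latitude `f`. -/
def sphereVec (t f : ℝ) : Space3 := !₂[cos f * sin t, -(cos f * cos t), sin f]

/-- The point of `kA` of parameter `t`. -/
def arcA (t : ℝ) : Space3 := !₂[sin t, -1/2 - cos t, 0]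

lemma norm_sphereVec (t f : ℝ) : ‖sphereVec t f‖ = 1 := by
  rw [norm_eq_one_iff_sq]
  simp [sphereVec]
  nlinarith [sin_sq_add_cos_sq t, sin_sq_add_cos_sq f]

lemma sphereVec_ne_zero (t f : ℝ) : sphereVec t f ≠ 0 := by
  intro h
  have := norm_sphereVec t f
  simp [h] at this

lemma radA_sphereVec {f : ℝ} (hf : 0 < cos f) (t : ℝ) : radA (sphereVec t f) = cos f := by
  rw [radA, Real.sqrt_eq_iff_mul_self_eq_of_pos hf]
  simp [sphereVec]
  nlinarith [sin_sq_add_cos_sq t]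

lemma ptA_sphereVec {f : ℝ} (hf : 0 < cos f) (t : ℝ) : ptA (sphereVec t f) = arcA t := by
  rw [ptA, radA_sphereVec hf]
  apply space3_ext <;> simp [sphereVec, arcA] <;> field_simp
  ring

lemma suppB_lt_suppA_sphereVec_iff {f : ℝ} (hf : 0 < cos f) (t : ℝ) :
    suppB (sphereVec t f) < suppA (sphereVec t f) ↔
      sin f ^ 2 < cos f ^ 2 * (1 + 2 * cos t) := by
  have e1 : sphereVec t f 1 = -(cos f * cos t) := rfl
  have e2 : sphereVec t f 2 = sin f := rfl
  have h : suppB (sphereVec t f) < suppA (sphereVec t f) ↔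
      √((cos f * cos t) ^ 2 + sin f ^ 2) < cos f * (1 + cos t) := by
    rw [suppA, suppB, radA_sphereVec hf, radB, e1, e2, neg_sq]
    constructor <;> intro h <;> linarith
  rw [h]
  constructor
  · intro h
    rw [Real.sqrt_lt' ((Real.sqrt_nonneg _).trans_lt h)] at h
    nlinarith
  · intro h
    have h1 : 0 < 1 + cos t := by
      by_contra hcon
      nlinarith [sq_nonneg (sin f), mul_pos hf hf]
    rw [Real.sqrt_lt' (mul_pos hf h1)]
    nlinarith

lemma sin_sq_lt_iff_abs_lt_dualParam {f t : ℝ} (hf : |f| < π / 2) (ht : -(1/2) < cos t) :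
    sin f ^ 2 < cos f ^ 2 * (1 + 2 * cos t) ↔ |f| < dualParam t / 2 := by
  have hc : 0 < 1 + cos t := by linarith
  have h1 : |f| < dualParam t / 2 ↔ -(cos t / (1 + cos t)) < cos (2 * f) := by
    have e : cos (2 * f) = cos (2 * |f|) := by
      rw [← cos_abs (2 * f), abs_mul, abs_two]
    rw [e, lt_div_iff₀ two_pos, mul_comm |f|, dualParam]
    have hm : 2 * |f| ∈ Set.Icc 0 π := ⟨by positivity, by linarith⟩
    have hb1 : -1 ≤ -(cos t / (1 + cos t)) := by
      rw [neg_le_neg_iff, div_le_one hc]; linarith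
    have hb2 : -(cos t / (1 + cos t)) ≤ 1 := by
      rw [neg_le, le_div_iff₀ hc]; linarith
    rw [← Real.strictAntiOn_cos.lt_iff_gt ⟨arccos_nonneg _, arccos_le_pi _⟩ hm,
      cos_arccos hb1 hb2]
  rw [h1, neg_lt_iff_pos_add, ← mul_pos_iff_of_pos_right hc, cos_two_mul, sin_sq]
  have e : (2 * cos f ^ 2 - 1 + cos t / (1 + cos t)) * (1 + cos t) =
      2 * cos f ^ 2 * (1 + cos t) - 1 := by field_simp; ring
  rw [e]
  constructor <;> intro h <;> linarith

lemma neg_half_lt_cos_iff {t : ℝ} (ht : t ∈ Set.Ioc (-π) π) :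
    -(1/2) < cos t ↔ t ∈ Set.Ioo (-(2 * π / 3)) (2 * π / 3) := by
  have hπ := Real.pi_pos
  have e : cos (2 * π / 3) = -(1/2) := by
    have : 2 * π / 3 = π - π / 3 := by ring
    rw [this, cos_pi_sub, cos_pi_div_three]
  rw [← e, ← cos_abs t, Real.strictAntiOn_cos.lt_iff_gt ⟨by positivity, by linarith⟩
    ⟨abs_nonneg t, abs_le.2 ⟨ht.1.le, ht.2⟩⟩, abs_lt]
  rfl

/-- The parameter domain of the exterior points whose nearest point lies inside an arc of `kA`. -/
def arcDomain (ρ : ℝ) : Set (ℝ × ℝ × ℝ) :=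
  {q | q.1 ∈ Set.Ioo (-(2 * π / 3)) (2 * π / 3) ∧ |q.2.1| < dualParam q.1 / 2 ∧
    q.2.2 ∈ Set.Ioc 0 ρ}

/-- Parametrization of the exterior points whose nearest point lies inside an arc of `kA`. -/
def arcExterior (q : ℝ × ℝ × ℝ) : Space3 := arcA q.1 + q.2.2 • sphereVec q.1 q.2.1

lemma dualParam_le_pi (t : ℝ) : dualParam t ≤ π := arccos_le_pi _

lemma arcDomain_facts {ρ : ℝ} {q : ℝ × ℝ × ℝ} (hq : q ∈ arcDomain ρ) :
    q.1 ∈ Set.Ioc (-π) π ∧ |q.2.1| < π / 2 ∧ 0 < cos q.2.1 ∧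
      IsNormalAt (arcA q.1) (sphereVec q.1 q.2.1) ∧
      suppB (sphereVec q.1 q.2.1) < suppA (sphereVec q.1 q.2.1) := by
  obtain ⟨ht, hf, -⟩ := hq
  have hπ := Real.pi_pos
  have ht' : q.1 ∈ Set.Ioc (-π) π := ⟨by linarith [ht.1], by linarith [ht.2]⟩
  have hf' : |q.2.1| < π / 2 := by linarith [dualParam_le_pi q.1]
  have hcos : 0 < cos q.2.1 := cos_pos_of_mem_Ioo (abs_lt.1 hf')
  have hlt := (suppB_lt_suppA_sphereVec_iff hcos q.1).2
    ((sin_sq_lt_iff_abs_lt_dualParam hf' ((neg_half_lt_cos_iff ht').2 ht)).2 hf)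
  refine ⟨ht', hf', hcos, ?_, hlt⟩
  rw [← ptA_sphereVec hcos]
  exact isNormalAt_ptA (sphereVec_ne_zero _ _) hlt.le

lemma shell_eq_arcExterior_image (ρ : ℝ) :
    shell ρ (fun v => suppB v < suppA v) = arcExterior '' arcDomain ρ := by
  ext y
  rw [mem_shell_iff (fun d hd v => by
    rw [suppA_smul hd.le, suppB_smul hd.le, mul_lt_mul_iff_right₀ hd])]
  constructor
  · rintro ⟨p, u, d, hn, hu, hd, hc, rfl⟩
    have hr := radA_pos_of_le hn.2.1 hc.le
    have hA := radA_sq u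
    obtain ⟨s, hs, hp, -, hs0⟩ := exists_eq_of_suppO_le hn.1 hn.2.1 hn.2.2
    obtain rfl := hs0 hc
    rw [norm_eq_one_iff_sq] at hu
    obtain ⟨t, ht, hct, hst⟩ := exists_cos_sin_eq (a := - u 1 / radA u) (b := u 0 / radA u) (by
      field_simp; linarith)
    have h2 : u 2 ^ 2 < 1 := by nlinarith
    have h2' := abs_lt.1 ((sq_lt_one_iff_abs_lt_one _).1 h2)
    have hsf : sin (arcsin (u 2)) = u 2 := sin_arcsin h2'.1.le h2'.2.le
    have hcf : cos (arcsin (u 2)) = radA u := by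
      rw [cos_arcsin, radA]; congr 1; linarith
    have hf : |arcsin (u 2)| < π / 2 :=
      abs_lt.2 ⟨neg_pi_div_two_lt_arcsin.2 h2'.1, arcsin_lt_pi_div_two.2 h2'.2⟩
    have hcpos : 0 < cos (arcsin (u 2)) := hcf ▸ hr
    have hue : u = sphereVec t (arcsin (u 2)) := by
      apply space3_ext
      · simp [sphereVec, hcf, hst]; field_simp
      · simp [sphereVec, hcf, hct]; field_simp
      · simp [sphereVec, hsf]
    have hc' := hc
    rw [hue, suppB_lt_suppA_sphereVec_iff hcpos] at hc'
    have hct' : -(1/2) < cos t := by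
      by_contra hcon
      nlinarith [sq_nonneg (sin (arcsin (u 2))), sq_nonneg (cos (arcsin (u 2)))]
    refine ⟨(t, arcsin (u 2), d), ⟨(neg_half_lt_cos_iff ht).1 hct',
      (sin_sq_lt_iff_abs_lt_dualParam hf hct').1 hc', hd⟩, ?_⟩
    rw [hp, arcExterior]
    simp only [sub_zero, one_smul, zero_smul, add_zero]
    rw [← ptA_sphereVec hcpos t, ← hue]
  · rintro ⟨⟨t, f, d⟩, hq, rfl⟩
    obtain ⟨-, -, -, hn, hlt⟩ := arcDomain_facts hq
    exact ⟨arcA t, sphereVec t f, d, hn, norm_sphereVec t f, hq.2.2, hlt, rfl⟩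

lemma arcExterior_injOn (ρ : ℝ) : Set.InjOn arcExterior (arcDomain ρ) := by
  rintro ⟨t, f, d⟩ hq ⟨t', f', d'⟩ hq' h
  obtain ⟨ht, hf, -, hn, -⟩ := arcDomain_facts hq
  obtain ⟨ht', hf', -, hn', -⟩ := arcDomain_facts hq'
  have hd := hq.2.2.1
  have hd' := hq'.2.2.1
  simp only at ht hf hn ht' hf' hn' hd hd'
  obtain ⟨e1, e2⟩ := ((isNormalAt_smul_iff hd).2 hn).eq_of_add_eq ((isNormalAt_smul_iff hd').2 hn') h
  obtain ⟨rfl, e3⟩ := eq_of_smul_eq_smul_of_norm_eq_one hd hd' (norm_sphereVec _ _)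
    (norm_sphereVec _ _) e2
  have hs : sin t = sin t' := congrArg (fun u : Space3 => u 0) e1
  have hc : -1/2 - cos t = -1/2 - cos t' := congrArg (fun u : Space3 => u 1) e1
  have hsf : sin f = sin f' := congrArg (fun u : Space3 => u 2) e3
  obtain rfl := eq_of_cos_eq_sin_eq ht ht' (by linarith) hs
  have hf1 := abs_lt.1 hf
  have hf2 := abs_lt.1 hf'
  obtain rfl := Real.injOn_sin ⟨hf1.1.le, hf1.2.le⟩ ⟨hf2.1.le, hf2.2.le⟩ hsf
  rfl

lemma measurable_dualParam : Measurable dualParam := by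
  unfold dualParam
  exact Real.measurable_arccos.comp (by fun_prop)

lemma measurableSet_arcDomain (ρ : ℝ) : MeasurableSet (arcDomain ρ) := by
  have := measurable_dualParam
  refine (measurable_fst measurableSet_Ioo).inter (MeasurableSet.inter ?_ ?_)
  · exact measurableSet_lt (f := fun q : ℝ × ℝ × ℝ => |q.2.1|)
      (g := fun q : ℝ × ℝ × ℝ => dualParam q.1 / 2) (by fun_prop) (by fun_prop)
  · exact (measurable_snd.comp measurable_snd) measurableSet_Ioc

/-- The linear form on `ℝ × ℝ × ℝ` with coefficients `c`. -/
def linForm (c : Fin 3 → ℝ) : ℝ × ℝ × ℝ →L[ℝ] ℝ :=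
  c 0 • ContinuousLinearMap.fst ℝ ℝ (ℝ × ℝ) +
    (c 1 • (ContinuousLinearMap.fst ℝ ℝ ℝ).comp (ContinuousLinearMap.snd ℝ ℝ (ℝ × ℝ)) +
      c 2 • (ContinuousLinearMap.snd ℝ ℝ ℝ).comp (ContinuousLinearMap.snd ℝ ℝ (ℝ × ℝ)))

lemma linForm_apply (c : Fin 3 → ℝ) (q : ℝ × ℝ × ℝ) :
    linForm c q = c 0 * q.1 + (c 1 * q.2.1 + c 2 * q.2.2) := by
  simp [linForm]

/-- The coordinates of a point of space. -/
def coords : Space3 →L[ℝ] ℝ × ℝ × ℝ :=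
  (EuclideanSpace.proj 0).prod ((EuclideanSpace.proj 1).prod (EuclideanSpace.proj 2))

lemma coords_apply (p : Space3) : coords p = (p 0, p 1, p 2) := rfl

lemma measurePreserving_coords : MeasurePreserving coords := by
  have h1 := EuclideanSpace.volume_preserving_symm_measurableEquiv_toLp (Fin 3)
  have h2 := volume_preserving_piFinSuccAbove (fun _ : Fin 3 => ℝ) 0
  have h3 := (MeasurePreserving.id (volume : Measure ℝ)).prod (volume_preserving_finTwoArrow ℝ)
  exact h3.comp (h2.comp h1)

lemma coords_bijective : Function.Bijective coords :=
  ⟨fun p q h => by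
    simp only [coords_apply, Prod.mk.injEq] at h
    exact space3_ext h.1 h.2.1 h.2.2, fun q => ⟨!₂[q.1, q.2.1, q.2.2], rfl⟩⟩

/-- Change of variables for a parametrized region of space. -/
lemma volume_image_eq_lintegral_det {F : ℝ × ℝ × ℝ → Space3} {D : Set (ℝ × ℝ × ℝ)}
    {M : ℝ × ℝ × ℝ → Matrix (Fin 3) (Fin 3) ℝ} (hD : MeasurableSet D)
    (hF : ∀ q ∈ D, ∀ i, HasFDerivAt (fun q => F q i) (linForm (M q i)) q) (hinj : Set.InjOn F D) :
    MeasurableSet (F '' D) ∧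
      volume (F '' D) = ∫⁻ q in D, ENNReal.ofReal |(M q).det| := by
  set S : Set Space3 := coords ⁻¹' D with hS
  have hSm : MeasurableSet S := measurePreserving_coords.measurable hD
  have himg : (F ∘ coords) '' S = F '' D := by
    rw [Set.image_comp, hS, Set.image_preimage_eq _ coords_bijective.2]
  have hinj' : Set.InjOn (F ∘ coords) S := hinj.comp coords_bijective.1.injOn fun p hp => hp
  have hder : ∀ p ∈ S, HasFDerivWithinAt (F ∘ coords)
      (Matrix.toEuclideanCLM (𝕜 := ℝ) (M (coords p))) S p := by
    intro p hp
    rw [hasFDerivWithinAt_euclidean]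
    intro i
    have := ((hF (coords p) hp i).comp p coords.hasFDerivAt).hasFDerivWithinAt (s := S)
    refine this.congr_fderiv (ContinuousLinearMap.ext fun v => ?_)
    change linForm (M (coords p) i) (coords v) =
      (Matrix.toEuclideanCLM (𝕜 := ℝ) (M (coords p)) v) i
    rw [Matrix.ofLp_toEuclideanCLM, linForm_apply, coords_apply v]
    simp [Matrix.mulVec, dotProduct, Fin.sum_univ_three, add_assoc]
  refine ⟨himg ▸ measurable_image_of_fderivWithin hSm hder hinj', ?_⟩
  rw [← himg, ← lintegral_abs_det_fderiv_eq_addHaar_image volume hSm hder hinj']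
  have hdet : ∀ p, (Matrix.toEuclideanCLM (𝕜 := ℝ) (M (coords p))).det = (M (coords p)).det := by
    intro p
    rw [ContinuousLinearMap.det, Matrix.coe_toEuclideanCLM_eq_toEuclideanLin,
      Matrix.toEuclideanLin, Matrix.toLpLin_eq_toLin, LinearMap.det_toLin]
  simp_rw [hdet]
  exact measurePreserving_coords.setLIntegral_comp_preimage_emb
    (coords.continuous.measurableEmbedding coords_bijective.1)
    (fun q => ENNReal.ofReal |(M q).det|) D

lemma hasDerivAt_delta (x : ℝ) : HasDerivAt delta (-(3/4 * sin x * cos x) / delta x) x := by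
  have h := (((hasDerivAt_sin x).pow 2).const_mul (3/4)).const_sub 1 |>.sqrt (delta_sq_pos x).ne'
  refine h.congr_deriv ?_
  change _ / (2 * delta x) = _
  have := delta_pos x
  simp
  field_simp

lemma hasDerivAt_ruleNormal_zero (x : ℝ) :
    HasDerivAt (fun x => ruleNormal x 0) (√3 * cos x / 2) x :=
  ((hasDerivAt_sin x).const_mul √3).div_const 2

lemma hasDerivAt_ruleNormal_one (x : ℝ) :
    HasDerivAt (fun x => ruleNormal x 1)
      (3 * sin x * cos x * (1 + 2 * delta x ^ 2) / (8 * delta x ^ 3)) x := by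
  have hp := delta_pos x
  refine HasDerivAt.congr_deriv (((((hasDerivAt_delta x).pow 2).const_mul 2).const_sub 1).div
    ((hasDerivAt_delta x).const_mul 2) (by positivity)) ?_
  simp
  field_simp
  ring

lemma hasDerivAt_ruleNormal_two (x : ℝ) :
    HasDerivAt (fun x => ruleNormal x 2) (-(√3 * sin x) / (8 * delta x ^ 3)) x := by
  have hp := delta_pos x
  refine HasDerivAt.congr_deriv (((hasDerivAt_cos x).const_mul √3).div
    ((hasDerivAt_delta x).const_mul 2) (by positivity)) ?_
  simp
  field_simp
  linear_combination 8 * sin x * cos_sq_eq_delta x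

lemma hasDerivAt_ruleA_zero (x : ℝ) :
    HasDerivAt (fun x => ruleA x 0) (√3 * cos x * (2 * delta x ^ 2 - 1) / delta x) x := by
  have hp := delta_pos x
  refine HasDerivAt.congr_deriv (((hasDerivAt_sin x).const_mul √3).mul (hasDerivAt_delta x)) ?_
  field_simp
  linear_combination -cos x * sin_sq_eq_delta x

lemma hasDerivAt_ruleA_one (x : ℝ) :
    HasDerivAt (fun x => ruleA x 1) (3 * sin x * cos x) x := by
  have hp := delta_pos x
  refine HasDerivAt.congr_deriv ((((hasDerivAt_delta x).pow 2).const_mul 2).const_sub (1/2)) ?_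
  simp
  field_simp
  ring

lemma hasDerivAt_ruleB_one (x : ℝ) :
    HasDerivAt (fun x => ruleB x 1) (3 * sin x * cos x / (4 * delta x ^ 4)) x := by
  have hp := delta_pos x
  refine HasDerivAt.congr_deriv (((hasDerivAt_const x (1:ℝ)).div
    (((hasDerivAt_delta x).pow 2).const_mul 2) (by simp; positivity)).sub_const (1/2)) ?_
  simp
  field_simp

lemma hasDerivAt_ruleB_two (x : ℝ) :
    HasDerivAt (fun x => ruleB x 2)
      (√3 * sin x * (2 * delta x ^ 2 - 1) / (4 * delta x ^ 4)) x := by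
  have hp := delta_pos x
  refine HasDerivAt.congr_deriv (((hasDerivAt_cos x).const_mul √3).div
    (((hasDerivAt_delta x).pow 2).const_mul 2) (by simp; positivity)) ?_
  simp
  field_simp
  linear_combination 2 * sin x * cos_sq_eq_delta x

/-- The derivative of `ruleA`. -/
def derivRuleA (x : ℝ) : Fin 3 → ℝ :=
  ![√3 * cos x * (2 * delta x ^ 2 - 1) / delta x, 3 * sin x * cos x, 0]

/-- The derivative of `ruleB`. -/
def derivRuleB (x : ℝ) : Fin 3 → ℝ :=
  ![0, 3 * sin x * cos x / (4 * delta x ^ 4),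
    √3 * sin x * (2 * delta x ^ 2 - 1) / (4 * delta x ^ 4)]

/-- The derivative of `ruleNormal`. -/
def derivRuleNormal (x : ℝ) : Fin 3 → ℝ :=
  ![√3 * cos x / 2, 3 * sin x * cos x * (1 + 2 * delta x ^ 2) / (8 * delta x ^ 3),
    -(√3 * sin x) / (8 * delta x ^ 3)]

lemma hasDerivAt_ruleA (x : ℝ) (i : Fin 3) :
    HasDerivAt (fun x => ruleA x i) (derivRuleA x i) x := by
  fin_cases i
  · exact hasDerivAt_ruleA_zero x
  · exact hasDerivAt_ruleA_one x
  · exact hasDerivAt_const x 0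

lemma hasDerivAt_ruleB (x : ℝ) (i : Fin 3) :
    HasDerivAt (fun x => ruleB x i) (derivRuleB x i) x := by
  fin_cases i
  · exact hasDerivAt_const x 0
  · exact hasDerivAt_ruleB_one x
  · exact hasDerivAt_ruleB_two x

lemma hasDerivAt_ruleNormal (x : ℝ) (i : Fin 3) :
    HasDerivAt (fun x => ruleNormal x i) (derivRuleNormal x i) x := by
  fin_cases i
  · exact hasDerivAt_ruleNormal_zero x
  · exact hasDerivAt_ruleNormal_one x
  · exact hasDerivAt_ruleNormal_two x

lemma hasFDerivAt_comp_fst {f : ℝ → ℝ} {f' : ℝ} {q : ℝ × ℝ × ℝ} (hf : HasDerivAt f f' q.1) :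
    HasFDerivAt (fun q : ℝ × ℝ × ℝ => f q.1) (linForm ![f', 0, 0]) q :=
  (hf.comp_hasFDerivAt q hasFDerivAt_fst).congr_fderiv
    (ContinuousLinearMap.ext fun v => by simp [linForm_apply])

lemma hasFDerivAt_comp_snd_fst {f : ℝ → ℝ} {f' : ℝ} {q : ℝ × ℝ × ℝ}
    (hf : HasDerivAt f f' q.2.1) :
    HasFDerivAt (fun q : ℝ × ℝ × ℝ => f q.2.1) (linForm ![0, f', 0]) q :=
  (HasDerivAt.comp_hasFDerivAt (f := fun q : ℝ × ℝ × ℝ => q.2.1) q hf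
    hasFDerivAt_snd.fst).congr_fderiv (ContinuousLinearMap.ext fun v => by simp [linForm_apply])

lemma hasFDerivAt_snd_fst (q : ℝ × ℝ × ℝ) :
    HasFDerivAt (fun q : ℝ × ℝ × ℝ => q.2.1) (linForm ![0, 1, 0]) q :=
  hasFDerivAt_comp_snd_fst (hasDerivAt_id q.2.1)

lemma hasFDerivAt_snd_snd (q : ℝ × ℝ × ℝ) :
    HasFDerivAt (fun q : ℝ × ℝ × ℝ => q.2.2) (linForm ![0, 0, 1]) q :=
  hasFDerivAt_snd.snd.congr_fderiv (ContinuousLinearMap.ext fun v => by simp [linForm_apply])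

/-- The Jacobian matrix of `ruledExterior`. -/
def jacRuledExterior (q : ℝ × ℝ × ℝ) : Matrix (Fin 3) (Fin 3) ℝ := fun i =>
  ![(1 - q.2.1) * derivRuleA q.1 i + q.2.1 * derivRuleB q.1 i + q.2.2 * derivRuleNormal q.1 i,
    ruleB q.1 i - ruleA q.1 i, ruleNormal q.1 i]

lemma hasFDerivAt_ruledExterior (q : ℝ × ℝ × ℝ) (i : Fin 3) :
    HasFDerivAt (fun q => ruledExterior q i) (linForm (jacRuledExterior q i)) q := by
  have hs := hasFDerivAt_snd_fst q
  refine (((((hasFDerivAt_const (1:ℝ) q).sub hs).mul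
    (hasFDerivAt_comp_fst (hasDerivAt_ruleA q.1 i))).add
    (hs.mul (hasFDerivAt_comp_fst (hasDerivAt_ruleB q.1 i)))).add
    ((hasFDerivAt_snd_snd q).mul
      (hasFDerivAt_comp_fst (hasDerivAt_ruleNormal q.1 i)))).congr_fderiv ?_
  refine ContinuousLinearMap.ext fun v => ?_
  simp [linForm_apply, jacRuledExterior]
  ring

/-- The Jacobian matrix of `ruledCone`. -/
def jacRuledCone (q : ℝ × ℝ × ℝ) : Matrix (Fin 3) (Fin 3) ℝ := fun i =>
  ![q.2.2 * ((1 - q.2.1) * derivRuleA q.1 i + q.2.1 * derivRuleB q.1 i),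
    q.2.2 * (ruleB q.1 i - ruleA q.1 i),
    (1 - q.2.1) * ruleA q.1 i + q.2.1 * ruleB q.1 i]

lemma hasFDerivAt_ruledCone (q : ℝ × ℝ × ℝ) (i : Fin 3) :
    HasFDerivAt (fun q => ruledCone q i) (linForm (jacRuledCone q i)) q := by
  have hs := hasFDerivAt_snd_fst q
  refine ((hasFDerivAt_snd_snd q).mul ((((hasFDerivAt_const (1:ℝ) q).sub hs).mul
    (hasFDerivAt_comp_fst (hasDerivAt_ruleA q.1 i))).add
    (hs.mul (hasFDerivAt_comp_fst (hasDerivAt_ruleB q.1 i))))).congr_fderiv ?_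
  refine ContinuousLinearMap.ext fun v => ?_
  simp [linForm_apply, jacRuledCone]
  ring

/-- The Jacobian matrix of `arcExterior`. -/
def jacArcExterior (q : ℝ × ℝ × ℝ) : Matrix (Fin 3) (Fin 3) ℝ :=
  !![(1 + q.2.2 * cos q.2.1) * cos q.1, -(q.2.2 * sin q.2.1 * sin q.1), cos q.2.1 * sin q.1;
    (1 + q.2.2 * cos q.2.1) * sin q.1, q.2.2 * sin q.2.1 * cos q.1, -(cos q.2.1 * cos q.1);
    0, q.2.2 * cos q.2.1, sin q.2.1]

lemma hasFDerivAt_arcExterior (q : ℝ × ℝ × ℝ) (i : Fin 3) :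
    HasFDerivAt (fun q => arcExterior q i) (linForm (jacArcExterior q i)) q := by
  have hs := hasFDerivAt_comp_fst (hasDerivAt_sin q.1)
  have hc := hasFDerivAt_comp_fst (hasDerivAt_cos q.1)
  have hs' := hasFDerivAt_comp_snd_fst (hasDerivAt_sin q.2.1)
  have hc' := hasFDerivAt_comp_snd_fst (hasDerivAt_cos q.2.1)
  have hd := hasFDerivAt_snd_snd q
  fin_cases i
  · refine (hs.add (hd.mul (hc'.mul hs))).congr_fderiv ?_
    refine ContinuousLinearMap.ext fun v => ?_
    simp [linForm_apply, jacArcExterior]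
    ring
  · refine ((hc.const_sub (-1/2)).add (hd.mul (hc'.mul hc).neg)).congr_fderiv ?_
    refine ContinuousLinearMap.ext fun v => ?_
    simp [linForm_apply, jacArcExterior]
    ring
  · refine ((hasFDerivAt_const (0:ℝ) q).add (hd.mul hs')).congr_fderiv ?_
    refine ContinuousLinearMap.ext fun v => ?_
    simp [linForm_apply, jacArcExterior]
    ring

lemma det_jacArcExterior (q : ℝ × ℝ × ℝ) :
    (jacArcExterior q).det = q.2.2 * (1 + q.2.2 * cos q.2.1) := by
  rw [Matrix.det_fin_three]
  simp [jacArcExterior]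
  have h1 := sin_sq_add_cos_sq q.1
  have h2 := sin_sq_add_cos_sq q.2.1
  linear_combination (q.2.2 * (1 + q.2.2 * cos q.2.1)) * (sin q.2.1 ^ 2 + cos q.2.1 ^ 2) * h1 +
    (q.2.2 * (1 + q.2.2 * cos q.2.1)) * h2

lemma det_jacRuledExterior (q : ℝ × ℝ × ℝ) :
    (jacRuledExterior q).det =
      (3 * cos q.1 ^ 2 * (1 - q.2.1) + 3/2 * sin q.1 ^ 2 * q.2.1) / delta q.1 ^ 2 +
        3/2 * q.2.2 / delta q.1 := by
  have hp := delta_pos q.1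
  have hC : cos q.1 ^ 2 = (4 * delta q.1 ^ 2 - 1) / 3 := by linarith [cos_sq_eq_delta q.1]
  have hS : sin q.1 ^ 2 = (4 - 4 * delta q.1 ^ 2) / 3 := by linarith [sin_sq_eq_delta q.1]
  have hw := sqrt_three_sq
  rw [Matrix.det_fin_three]
  simp [jacRuledExterior, derivRuleA, derivRuleB, derivRuleNormal, ruleA, ruleB, ruleNormal]
  generalize delta q.1 = D at *
  generalize sin q.1 = S at *
  generalize cos q.1 = C at *
  generalize √3 = w at *
  field_simp
  ring_nf
  simp only [hw, hC, hS]
  ring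

lemma det_jacRuledCone (q : ℝ × ℝ × ℝ) :
    (jacRuledCone q).det = q.2.2 ^ 2 * ((1 + 2 * delta q.1 ^ 2) / (4 * delta q.1)) *
      ((3 * cos q.1 ^ 2 * (1 - q.2.1) + 3/2 * sin q.1 ^ 2 * q.2.1) / delta q.1 ^ 2) := by
  have hp := delta_pos q.1
  have hC : cos q.1 ^ 2 = (4 * delta q.1 ^ 2 - 1) / 3 := by linarith [cos_sq_eq_delta q.1]
  have hS : sin q.1 ^ 2 = (4 - 4 * delta q.1 ^ 2) / 3 := by linarith [sin_sq_eq_delta q.1]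
  have hw := sqrt_three_sq
  rw [Matrix.det_fin_three]
  simp [jacRuledCone, derivRuleA, derivRuleB, ruleA, ruleB]
  generalize delta q.1 = D at *
  generalize sin q.1 = S at *
  generalize cos q.1 = C at *
  generalize √3 = w at *
  field_simp
  ring_nf
  simp only [hw, hC, hS]
  ring

lemma continuous_delta : Continuous delta := by unfold delta; fun_prop

lemma ellipticK_eq : ellipticK (√3 / 2) = ∫ x in (0:ℝ)..(π/2), 1 / delta x := by
  simp [ellipticK, delta, div_pow]
  norm_num

lemma ellipticE_eq : ellipticE (√3 / 2) = ∫ x in (0:ℝ)..(π/2), delta x := by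
  simp [ellipticE, delta, div_pow]
  norm_num

lemma continuous_one_div_delta_pow (n : ℕ) : Continuous fun x => 1 / delta x ^ n :=
  continuous_const.div (continuous_delta.pow n) fun x => (pow_pos (delta_pos x) n).ne'

lemma integral_one_div_delta_sq : ∫ x in (0:ℝ)..(π/2), 1 / delta x ^ 2 = π := by
  have h : ∀ x ∈ Set.uIcc 0 (π/2), HasDerivAt
      (fun x => 2 * x - 2 * arctan (sin x * cos x / (1 + cos x ^ 2))) (1 / delta x ^ 2) x := by
    intro x _
    have hc : 0 < 1 + cos x ^ 2 := by positivity
    have hu := ((hasDerivAt_sin x).mul (hasDerivAt_cos x)).div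
      (((hasDerivAt_cos x).pow 2).const_add 1) hc.ne'
    refine (((hasDerivAt_id x).const_mul 2).sub (hu.arctan.const_mul 2)).congr_deriv ?_
    have hD : 0 < 1 + 3 * cos x ^ 2 := by positivity
    have hs : sin x ^ 2 = 1 - cos x ^ 2 := sin_sq x
    rw [show delta x ^ 2 = (1 + 3 * cos x ^ 2) / 4 by linarith [cos_sq_eq_delta x]]
    have hden : (1 + cos x ^ 2) ^ 2 + sin x ^ 2 * cos x ^ 2 = 1 + 3 * cos x ^ 2 := by
      rw [hs]; ring
    have e : 1 + (sin x * cos x / (1 + cos x ^ 2)) ^ 2 =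
        (1 + 3 * cos x ^ 2) / (1 + cos x ^ 2) ^ 2 := by
      rw [← hden]; field_simp
    simp only [Pi.mul_apply, Pi.div_apply, Pi.pow_apply, e]
    simp
    field_simp
    ring_nf
    simp only [hs]
    ring
  rw [intervalIntegral.integral_eq_sub_of_hasDerivAt h
    ((continuous_one_div_delta_pow 2).intervalIntegrable _ _)]
  simp
  ring

lemma integral_one_div_delta_cube :
    ∫ x in (0:ℝ)..(π/2), 1 / delta x ^ 3 = 4 * ellipticE (√3 / 2) := by
  have h : ∀ x ∈ Set.uIcc 0 (π/2), HasDerivAt (fun x => sin x * cos x / delta x)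
      (4/3 * delta x - 1/3 * (1 / delta x ^ 3)) x := by
    intro x _
    have hp := delta_pos x
    refine (((hasDerivAt_sin x).mul (hasDerivAt_cos x)).div
      (hasDerivAt_delta x) hp.ne').congr_deriv ?_
    have hC : cos x ^ 2 = (4 * delta x ^ 2 - 1) / 3 := by linarith [cos_sq_eq_delta x]
    have hS : sin x ^ 2 = (4 - 4 * delta x ^ 2) / 3 := by linarith [sin_sq_eq_delta x]
    simp
    generalize delta x = D at *
    generalize sin x = S at *
    generalize cos x = C at *
    field_simp
    ring_nf
    simp only [hC, hS]
    ring
  have hi := (continuous_delta.const_mul (4/3)).intervalIntegrable (μ := volume) 0 (π/2)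
  have hj := ((continuous_one_div_delta_pow 3).const_mul (1/3)).intervalIntegrable
    (μ := volume) 0 (π/2)
  have := intervalIntegral.integral_eq_sub_of_hasDerivAt h (hi.sub hj)
  rw [intervalIntegral.integral_sub hi hj, intervalIntegral.integral_const_mul,
    intervalIntegral.integral_const_mul, ← ellipticE_eq] at this
  simp at this ⊢
  linarith

lemma continuousOn_dualParam : ContinuousOn dualParam {t | 0 < 1 + cos t} :=
  continuous_arccos.comp_continuousOn
    (continuousOn_cos.div (by fun_prop) fun _ ht => (ne_of_gt ht)).neg

lemma integral_sin_dualParam :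
    ∫ t in (0:ℝ)..(2 * π / 3), sin (dualParam t / 2) = π / 2 := by
  have hlt : ∀ x, (√3 / 2 * sin x) ^ 2 < 1 := fun x => by
    rw [mul_pow, div_pow, sqrt_three_sq]; linarith [delta_sq_pos x]
  have hder : ∀ x ∈ Set.uIcc 0 (π/2), HasDerivAt (fun x => 2 * arcsin (√3 / 2 * sin x))
      (√3 * cos x / delta x) x := by
    intro x _
    have h1 : √3 / 2 * sin x ≠ 1 := fun h => by have := hlt x; rw [h] at this; norm_num at this
    have h2 : √3 / 2 * sin x ≠ -1 := fun h => by have := hlt x; rw [h] at this; norm_num at this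
    refine (((hasDerivAt_arcsin h2 h1).comp x
      ((hasDerivAt_sin x).const_mul (√3 / 2))).const_mul 2).congr_deriv ?_
    rw [mul_pow, div_pow, sqrt_three_sq, show (3:ℝ) / 2 ^ 2 = 3 / 4 by norm_num]
    change 2 * (1 / delta x * _) = _
    field_simp
  have hcos : ∀ x, cos (2 * arcsin (√3 / 2 * sin x)) = 2 * delta x ^ 2 - 1 := fun x => by
    rw [cos_two_mul, cos_arcsin, Real.sq_sqrt (by linarith [hlt x]), delta_sq, mul_pow, div_pow,
      sqrt_three_sq]
    ring
  have key := intervalIntegral.integral_comp_mul_deriv' (g := fun t => sin (dualParam t / 2)) hder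
    ((continuous_cos.const_mul √3).div continuous_delta
      fun x => (delta_pos x).ne').continuousOn
    ((continuous_sin.comp_continuousOn (continuousOn_dualParam.div_const 2)).mono (by
      rintro _ ⟨x, _, rfl⟩
      have := delta_pos x
      simp only [Set.mem_ofPred_eq, hcos]
      ring_nf
      positivity))
  have e0 : arcsin (√3 / 2) = π / 3 := by
    rw [← sin_pi_div_three, arcsin_sin] <;> linarith [Real.pi_pos]
  simp only [sin_zero, mul_zero, arcsin_zero, sin_pi_div_two, mul_one, e0] at key
  rw [show 2 * π / 3 = 2 * (π / 3) by ring, ← key]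
  have hval : ∫ x in (0:ℝ)..(π/2), (2 - 1/2 * (1 / delta x ^ 2)) = π / 2 := by
    rw [intervalIntegral.integral_sub (by simp)
      (((continuous_one_div_delta_pow 2).const_mul _).intervalIntegrable _ _),
      intervalIntegral.integral_const_mul, integral_one_div_delta_sq]
    simp
    ring
  refine Eq.trans (intervalIntegral.integral_congr fun x hx => ?_) hval
  rw [Set.uIcc_of_le (by positivity)] at hx
  have hp := delta_pos x
  have hc : 0 ≤ cos x := cos_nonneg_of_mem_Icc ⟨by linarith [hx.1, Real.pi_pos], hx.2⟩
  have hlow : (1:ℝ) / 4 ≤ delta x ^ 2 := by rw [delta_sq]; linarith [sin_sq_le_one x]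
  have hsin : sin (dualParam (2 * arcsin (√3 / 2 * sin x)) / 2) = √3 * cos x / (2 * delta x) := by
    have hq : (2 * delta x ^ 2 - 1) / (1 + (2 * delta x ^ 2 - 1)) = 1 - 1 / (2 * delta x ^ 2) := by
      field_simp; ring
    have hb : 1 / (2 * delta x ^ 2) ≤ 2 := by rw [div_le_iff₀ (by positivity)]; linarith
    have hb' : 0 < 1 / (2 * delta x ^ 2) := by positivity
    have hT : 0 ≤ dualParam (2 * arcsin (√3 / 2 * sin x)) := arccos_nonneg _
    have hT' := dualParam_le_pi (2 * arcsin (√3 / 2 * sin x))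
    have h0 : 0 ≤ sin (dualParam (2 * arcsin (√3 / 2 * sin x)) / 2) :=
      sin_nonneg_of_nonneg_of_le_pi (by linarith) (by linarith)
    rw [← sq_eq_sq₀ h0 (by positivity), sin_sq_eq_half_sub,
      mul_div_cancel₀ _ (two_ne_zero' ℝ), dualParam, hcos, hq,
      cos_arccos (by linarith) (by linarith), div_pow, mul_pow, sqrt_three_sq, mul_pow,
      cos_sq_eq_delta]
    field_simp
    ring
  simp only [Function.comp_apply, hsin]
  field_simp
  rw [sqrt_three_sq]
  linear_combination cos_sq_eq_delta x

lemma integral_dualParam_half_pi : ∫ t in (0:ℝ)..(π/2), dualParam t = π ^ 2 / 2 - constI := by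
  have hc : ContinuousOn (fun t => arccos (cos t / (1 + cos t))) (Set.uIcc 0 (π/2)) := by
    refine continuous_arccos.comp_continuousOn (continuousOn_cos.div (by fun_prop) fun t ht => ?_)
    rw [Set.uIcc_of_le (by positivity)] at ht
    have := cos_nonneg_of_mem_Icc ⟨by linarith [ht.1, Real.pi_pos], ht.2⟩
    positivity
  simp only [dualParam, arccos_neg]
  rw [intervalIntegral.integral_sub (by simp) hc.intervalIntegrable, constI]
  simp
  ring

lemma integral_dualParam :
    ∫ t in (0:ℝ)..(2 * π / 3), dualParam t = 3 * π ^ 2 / 4 - 2 * constI := by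
  have hπ := Real.pi_pos
  set u : ℝ → ℝ := fun s => cos s / (1 + cos s) with hu
  set T' : ℝ → ℝ := fun s => (-sin s / (1 + cos s) ^ 2) / √(1 - u s ^ 2) with hT'
  have hcos : ∀ s ∈ Set.uIcc (π/2) 0, 0 ≤ cos s := fun s hs => by
    rw [Set.uIcc_of_ge (by positivity)] at hs
    exact cos_nonneg_of_mem_Icc ⟨by linarith [hs.1], hs.2⟩
  have hub : ∀ s ∈ Set.uIcc (π/2) 0, 0 ≤ u s ∧ u s ≤ 1 / 2 := fun s hs => by
    have := hcos s hs
    exact ⟨by positivity, by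
      rw [hu]; dsimp only; rw [div_le_div_iff₀ (by positivity) (by positivity)]
      linarith [cos_le_one s]⟩
  have hder : ∀ s ∈ Set.uIcc (π/2) 0, HasDerivAt dualParam (T' s) s := by
    intro s hs
    have hc := hcos s hs
    have hb := hub s hs
    have hd := ((hasDerivAt_cos s).div ((hasDerivAt_cos s).const_add 1)
      (by positivity : (1 + cos s) ≠ 0)).neg
    refine ((hasDerivAt_arccos (x := -u s) (by linarith) (by linarith)).comp s hd).congr_deriv ?_
    simp only [hT', neg_sq]
    ring
  have hcT' : ContinuousOn T' (Set.uIcc (π/2) 0) := by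
    have hu' : ContinuousOn u (Set.uIcc (π/2) 0) :=
      continuousOn_cos.div (by fun_prop) fun s hs => by have := hcos s hs; positivity
    refine ContinuousOn.div (ContinuousOn.div (by fun_prop) (by fun_prop) fun s hs => ?_)
      (by fun_prop) fun s hs => ?_
    · have := hcos s hs
      positivity
    · exact (Real.sqrt_pos.2 (by nlinarith [hub s hs])).ne'
  have hT0 : dualParam 0 = 2 * π / 3 := by
    rw [dualParam, cos_zero, arccos_neg, show (1:ℝ) / (1 + 1) = cos (π / 3) by
      rw [cos_pi_div_three]; norm_num, arccos_cos (by positivity) (by linarith)]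
    ring
  have hT1 : dualParam (π/2) = π / 2 := by simp [dualParam]
  have hcosT : ∀ s ∈ Set.uIcc (π/2) 0, cos (dualParam s) = -u s := fun s hs => by
    have := hub s hs
    exact cos_arccos (by linarith) (by linarith)
  have hinv : ∀ s ∈ Set.uIcc (π/2) 0, dualParam (dualParam s) = s := fun s hs => by
    have hc := hcos s hs
    have e : -(-u s / (1 + -u s)) = cos s := by
      have : 1 + -u s = 1 / (1 + cos s) := by rw [hu]; field_simp; ring
      rw [this, hu]; field_simp
    rw [Set.uIcc_of_ge (by positivity)] at hs
    conv_lhs => rw [dualParam]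
    rw [hcosT s (by rwa [Set.uIcc_of_ge (by positivity)]), e, arccos_cos hs.1 (by linarith [hs.2])]
  have hpos : ∀ t ∈ Set.uIcc 0 (2 * π / 3), 0 < 1 + cos t := fun t ht => by
    rw [Set.uIcc_of_le (by positivity)] at ht
    have : cos π < cos t := cos_lt_cos_of_nonneg_of_le_pi ht.1 le_rfl (by linarith [ht.2])
    rw [cos_pi] at this
    linarith
  have hcont : ContinuousOn dualParam (Set.uIcc 0 (2 * π / 3)) := continuousOn_dualParam.mono hpos
  have hsub := intervalIntegral.integral_comp_mul_deriv' (g := dualParam) hder hcT'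
    (continuousOn_dualParam.mono (by
      rintro _ ⟨s, hs, rfl⟩
      have := hub s hs
      rw [Set.mem_ofPred_eq, hcosT s hs]
      linarith))
  rw [hT0, hT1] at hsub
  have hsub' : ∫ s in (π/2)..0, s * T' s = ∫ t in (π/2)..(2 * π / 3), dualParam t := by
    rw [← hsub]
    exact intervalIntegral.integral_congr fun s hs => by
      simp only [Function.comp_apply, hinv s hs]
  rw [intervalIntegral.integral_mul_deriv_eq_deriv_mul (u := fun s => s) (u' := fun _ => 1)
    (fun s _ => hasDerivAt_id s) hder (by simp) hcT'.intervalIntegrable, hT1] at hsub'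
  simp only [one_mul, intervalIntegral.integral_symm 0 (π/2), integral_dualParam_half_pi] at hsub'
  rw [← intervalIntegral.integral_add_adjacent_intervals (b := π/2)
    (hcont.mono (Set.uIcc_subset_uIcc_left (by
      rw [Set.uIcc_of_le (by positivity)]; constructor <;> linarith))).intervalIntegrable
    (hcont.mono (Set.uIcc_subset_uIcc_right (by
      rw [Set.uIcc_of_le (by positivity)]; constructor <;> linarith))).intervalIntegrable,
    ← hsub', integral_dualParam_half_pi]
  ring

lemma lintegral_prod_Ioc {K : ℝ × ℝ → ℝ} (hK : Continuous K) {a b c d : ℝ} (hab : a ≤ b)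
    (hcd : c ≤ d) {A : Set ℝ} (hA : A =ᵐ[volume] Set.Ioc a b)
    (h0 : ∀ x ∈ Set.Icc a b, ∀ y ∈ Set.Icc c d, 0 ≤ K (x, y)) :
    ∫⁻ r in A ×ˢ Set.Ioc c d, ENNReal.ofReal (K r) =
      ENNReal.ofReal (∫ x in a..b, ∫ y in c..d, K (x, y)) := by
  have hm : volume.restrict (A ×ˢ Set.Ioc c d) =
      volume.restrict (Set.Ioc a b ×ˢ Set.Ioc c d) := by
    rw [Measure.volume_eq_prod, ← Measure.prod_restrict, ← Measure.prod_restrict,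
      Measure.restrict_congr_set hA]
  have hi : IntegrableOn K (Set.Ioc a b ×ˢ Set.Ioc c d) volume :=
    (hK.continuousOn.integrableOn_compact (isCompact_Icc.prod isCompact_Icc)).mono_set
      (Set.prod_mono Set.Ioc_subset_Icc_self Set.Ioc_subset_Icc_self)
  rw [hm, ← ofReal_integral_eq_lintegral_ofReal hi
    ((ae_restrict_iff' (measurableSet_Ioc.prod measurableSet_Ioc)).2 (ae_of_all _ fun r hr =>
      h0 r.1 (Set.Ioc_subset_Icc_self hr.1) r.2 (Set.Ioc_subset_Icc_self hr.2)))]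
  rw [Measure.volume_eq_prod] at hi ⊢
  rw [setIntegral_prod _ hi, intervalIntegral.integral_of_le hab]
  simp only [intervalIntegral.integral_of_le hcd]

lemma lintegral_eq_of_slices {D : Set (ℝ × ℝ × ℝ)} (hD : MeasurableSet D) {I : Set ℝ}
    (hI : MeasurableSet I) {S : ℝ → Set (ℝ × ℝ)} (hS : ∀ t r, (t, r) ∈ D ↔ t ∈ I ∧ r ∈ S t)
    {f : ℝ × ℝ × ℝ → ENNReal} (hf : Measurable f) {a b : ℝ} (hab : a ≤ b)
    (hIab : I =ᵐ[volume] Set.Ioc a b) {g : ℝ → ℝ} (hg : ContinuousOn g (Set.Icc a b))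
    (hg0 : ∀ t ∈ Set.Icc a b, 0 ≤ g t)
    (hfg : ∀ t ∈ I, ∫⁻ r in S t, f (t, r) = ENNReal.ofReal (g t)) :
    ∫⁻ q in D, f q = ENNReal.ofReal (∫ t in a..b, g t) := by
  have hslice : ∀ t ∈ I, S t = Prod.mk t ⁻¹' D := fun t ht => by
    ext r; simp [hS, ht]
  rw [← lintegral_indicator hD, Measure.volume_eq_prod,
    lintegral_prod _ (hf.indicator hD).aemeasurable]
  have e : (fun t => ∫⁻ r, D.indicator f (t, r)) =
      I.indicator fun t => ENNReal.ofReal (g t) := by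
    ext t
    by_cases ht : t ∈ I
    · rw [Set.indicator_of_mem ht, ← hfg t ht, ← lintegral_indicator]
      · refine lintegral_congr fun r => ?_
        by_cases hr : r ∈ S t
        · rw [Set.indicator_of_mem hr, Set.indicator_of_mem ((hS t r).2 ⟨ht, hr⟩)]
        · rw [Set.indicator_of_notMem hr, Set.indicator_of_notMem fun h => hr ((hS t r).1 h).2]
      · rw [hslice t ht]
        exact measurable_prodMk_left hD
    · rw [Set.indicator_of_notMem ht]
      refine (lintegral_congr fun r => ?_).trans lintegral_zero
      exact Set.indicator_of_notMem (fun h => ht ((hS t r).1 h).1) _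
  rw [e, lintegral_indicator hI, Measure.restrict_congr_set hIab,
    intervalIntegral.integral_of_le hab, ofReal_integral_eq_lintegral_ofReal]
  · exact (hg.integrableOn_compact isCompact_Icc).mono_set Set.Ioc_subset_Icc_self
  · exact (ae_restrict_iff' measurableSet_Ioc).2 (ae_of_all _ fun t ht =>
      hg0 t (Set.Ioc_subset_Icc_self ht))

lemma integral_eq_four_mul_of_symm {g : ℝ → ℝ} (hg : Continuous g) (h1 : ∀ x, g (-x) = g x)
    (h2 : ∀ x, g (π - x) = g x) : ∫ x in (-π)..π, g x = 4 * ∫ x in (0:ℝ)..(π/2), g x := by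
  have hi : ∀ a b, IntervalIntegrable g volume a b := fun a b => hg.intervalIntegrable a b
  have e1 : ∫ x in (-π)..0, g x = ∫ x in (0:ℝ)..π, g x := by
    have := intervalIntegral.integral_comp_neg (a := 0) (b := π) g
    simpa [h1] using this.symm
  have e2 : ∫ x in (π/2)..π, g x = ∫ x in (0:ℝ)..(π/2), g x := by
    have := intervalIntegral.integral_comp_sub_left (a := 0) (b := π/2) g π
    simp only [h2, sub_zero, sub_half] at this
    exact this.symm
  rw [← intervalIntegral.integral_add_adjacent_intervals (hi (-π) 0) (hi 0 π), e1,
    ← intervalIntegral.integral_add_adjacent_intervals (hi 0 (π/2)) (hi (π/2) π), e2]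
  ring

lemma delta_neg (x : ℝ) : delta (-x) = delta x := by simp [delta]

lemma delta_pi_sub (x : ℝ) : delta (π - x) = delta x := by simp [delta]

/-- The area density factor of the ruled part of the surface. -/
def ruleDensity (x s : ℝ) : ℝ :=
  (3 * cos x ^ 2 * (1 - s) + 3/2 * sin x ^ 2 * s) / delta x ^ 2

lemma ruleDensity_nonneg (x : ℝ) {s : ℝ} (hs : s ∈ Set.Icc 0 1) : 0 ≤ ruleDensity x s := by
  have h1 : 0 ≤ 1 - s := by linarith [hs.2]
  have h2 := hs.1
  unfold ruleDensity
  positivity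

lemma continuous_ruleDensity : Continuous fun q : ℝ × ℝ × ℝ => ruleDensity q.1 q.2.1 := by
  have := continuous_delta
  exact Continuous.div (by fun_prop) (by fun_prop) fun q => (pow_pos (delta_pos q.1) 2).ne'

lemma ruleDensity_eq (x s : ℝ) :
    ruleDensity x s = 3 * cos x ^ 2 / delta x ^ 2 +
      (3/2 * sin x ^ 2 / delta x ^ 2 - 3 * cos x ^ 2 / delta x ^ 2) * s := by
  have := delta_pos x
  rw [ruleDensity]
  field_simp
  ring

lemma integral_ruleDensity (x : ℝ) :
    ∫ s in (0:ℝ)..1, ruleDensity x s = 1 + 1/2 * (1 / delta x ^ 2) := by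
  have hp := delta_pos x
  simp only [ruleDensity_eq]
  rw [intervalIntegral.integral_add (by simp) (Continuous.intervalIntegrable (by fun_prop) _ _),
    intervalIntegral.integral_const_mul, integral_id]
  simp
  field_simp
  linear_combination 2 * cos_sq_eq_delta x + sin_sq_eq_delta x

lemma measurableSet_ruled {A : Set ℝ} (hA : MeasurableSet A) (ρ : ℝ) :
    MeasurableSet (Set.Ioc (-π) π ×ˢ A ×ˢ Set.Ioc 0 ρ) :=
  measurableSet_Ioc.prod (hA.prod measurableSet_Ioc)

lemma lintegral_ruled {J : ℝ × ℝ × ℝ → ℝ} (hJ : Continuous J) {A : Set ℝ} (hA : MeasurableSet A)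
    (hA' : A =ᵐ[volume] Set.Ioc 0 1) {ρ : ℝ} (hρ : 0 ≤ ρ)
    (hJ0 : ∀ x, ∀ s ∈ Set.Icc (0:ℝ) 1, ∀ d ∈ Set.Icc 0 ρ, 0 ≤ J (x, s, d))
    {g : ℝ → ℝ} (hg : Continuous g) (hg0 : ∀ x, 0 ≤ g x)
    (hJg : ∀ x, ∫ s in (0:ℝ)..1, ∫ d in (0:ℝ)..ρ, J (x, s, d) = g x)
    (h1 : ∀ x, g (-x) = g x) (h2 : ∀ x, g (π - x) = g x) :
    ∫⁻ q in Set.Ioc (-π) π ×ˢ A ×ˢ Set.Ioc 0 ρ, ENNReal.ofReal (J q) =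
      ENNReal.ofReal (4 * ∫ x in (0:ℝ)..(π/2), g x) := by
  have hπ := Real.pi_pos
  rw [← integral_eq_four_mul_of_symm hg h1 h2]
  refine lintegral_eq_of_slices (measurableSet_ruled hA ρ) measurableSet_Ioc
    (S := fun _ => A ×ˢ Set.Ioc 0 ρ) (fun t r => Iff.rfl) (by fun_prop) (by linarith)
    (by rfl) hg.continuousOn (fun t _ => hg0 t) fun t _ => ?_
  rw [← hJg, lintegral_prod_Ioc (K := fun r => J (t, r)) (by fun_prop) zero_le_one hρ hA'
    (hJ0 t)]

lemma volume_ruledExterior {ρ : ℝ} (hρ : 0 ≤ ρ) :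
    MeasurableSet (shell ρ fun v => suppA v = suppB v) ∧
      volume (shell ρ fun v => suppA v = suppB v) =
        ENNReal.ofReal (4 * π * ρ + 3 * ellipticK (√3 / 2) * ρ ^ 2) := by
  rw [shell_eq_ruledExterior_image]
  have key := volume_image_eq_lintegral_det (measurableSet_ruled measurableSet_Icc ρ)
    (fun q _ => hasFDerivAt_ruledExterior q) (ruledExterior_injOn ρ)
  refine ⟨key.1, key.2.trans ?_⟩
  have hJ0 : ∀ x, ∀ s ∈ Set.Icc (0:ℝ) 1, ∀ d ∈ Set.Icc 0 ρ,
      0 ≤ ruleDensity x s + 3/2 * d / delta x := fun x s hs d hd => by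
    have := ruleDensity_nonneg x hs
    have := hd.1
    have := delta_pos x
    positivity
  have hcd := continuous_delta
  have hdiv := continuous_one_div_delta_pow 2
  have hdiv1 := continuous_one_div_delta_pow 1
  simp only [pow_one] at hdiv1
  have hJ : Continuous fun q : ℝ × ℝ × ℝ => ruleDensity q.1 q.2.1 + 3/2 * q.2.2 / delta q.1 :=
    continuous_ruleDensity.add (Continuous.div (by fun_prop) (by fun_prop)
      fun q => (delta_pos q.1).ne')
  have hI : (4 * ∫ x in (0:ℝ)..(π/2),
      (ρ * (1 + 1/2 * (1 / delta x ^ 2)) + 3/4 * ρ ^ 2 * (1 / delta x))) =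
      4 * π * ρ + 3 * ellipticK (√3 / 2) * ρ ^ 2 := by
    rw [intervalIntegral.integral_add (Continuous.intervalIntegrable (by fun_prop) _ _)
      (Continuous.intervalIntegrable (by fun_prop) _ _), intervalIntegral.integral_const_mul,
      intervalIntegral.integral_const_mul,
      intervalIntegral.integral_add (by simp) (Continuous.intervalIntegrable (by fun_prop) _ _),
      intervalIntegral.integral_const_mul, integral_one_div_delta_sq, ← ellipticK_eq]
    simp
    ring
  rw [← hI, ← lintegral_ruled hJ measurableSet_Icc Ioc_ae_eq_Icc.symm hρ hJ0 (by fun_prop)]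
  · refine setLIntegral_congr_fun (measurableSet_ruled measurableSet_Icc ρ) fun q hq => ?_
    simp only [det_jacRuledExterior]
    rw [abs_of_nonneg]
    · rfl
    · exact hJ0 q.1 q.2.1 hq.2.1 q.2.2 (Set.Ioc_subset_Icc_self hq.2.2)
  · intro x
    have := delta_pos x
    positivity
  · intro x
    have hin : ∀ s, ∫ d in (0:ℝ)..ρ, (ruleDensity x s + 3/2 * d / delta x) =
        ρ * ruleDensity x s + 3/4 * ρ ^ 2 * (1 / delta x) := fun s => by
      rw [intervalIntegral.integral_add (by simp) (Continuous.intervalIntegrable (by fun_prop) _ _),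
        intervalIntegral.integral_div, intervalIntegral.integral_const_mul, integral_id]
      simp
      ring
    simp only [hin]
    rw [intervalIntegral.integral_add _ (by simp), intervalIntegral.integral_const_mul,
      integral_ruleDensity]
    · simp
    · simp only [ruleDensity_eq]
      exact Continuous.intervalIntegrable (by fun_prop) _ _
  · intro x; simp only [delta_neg]
  · intro x; simp only [delta_pi_sub]

lemma integral_cone_density : (4 * ∫ x in (0:ℝ)..(π/2),
    (1/24 * (1 / delta x ^ 3) + (1/6 * (1 / delta x) + 1/6 * delta x))) =
      2 / 3 * (2 * ellipticE (√3 / 2) + ellipticK (√3 / 2)) := by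
  have h3 := ((continuous_one_div_delta_pow 3).const_mul (1/24)).intervalIntegrable
    (μ := volume) 0 (π/2)
  have h1 := ((continuous_one_div_delta_pow 1).const_mul (1/6)).intervalIntegrable
    (μ := volume) 0 (π/2)
  have h0 := (continuous_delta.const_mul (1/6)).intervalIntegrable (μ := volume) 0 (π/2)
  simp only [pow_one] at h1
  rw [intervalIntegral.integral_add h3 (h1.add h0), intervalIntegral.integral_add h1 h0,
    intervalIntegral.integral_const_mul, intervalIntegral.integral_const_mul,
    intervalIntegral.integral_const_mul, integral_one_div_delta_cube, ← ellipticK_eq,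
    ← ellipticE_eq]
  ring

lemma volume_ruledCone :
    volume (ruledCone '' (Set.Ioc (-π) π ×ˢ Set.Ioo (0:ℝ) 1 ×ˢ Set.Ioc (0:ℝ) 1)) =
      ENNReal.ofReal (2 / 3 * (2 * ellipticE (√3 / 2) + ellipticK (√3 / 2))) := by
  have key := volume_image_eq_lintegral_det (measurableSet_ruled measurableSet_Ioo 1)
    (fun q _ => hasFDerivAt_ruledCone q) ruledCone_injOn
  refine key.2.trans ?_
  have hJ0 : ∀ x, ∀ s ∈ Set.Icc (0:ℝ) 1, ∀ d ∈ Set.Icc (0:ℝ) 1,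
      0 ≤ d ^ 2 * ((1 + 2 * delta x ^ 2) / (4 * delta x)) * ruleDensity x s :=
    fun x s hs d hd => by
      have := ruleDensity_nonneg x hs
      have := delta_pos x
      positivity
  have hcd := continuous_delta
  have hdiv3 := continuous_one_div_delta_pow 3
  have hdiv1 := continuous_one_div_delta_pow 1
  simp only [pow_one] at hdiv1
  have hJ : Continuous fun q : ℝ × ℝ × ℝ =>
      q.2.2 ^ 2 * ((1 + 2 * delta q.1 ^ 2) / (4 * delta q.1)) * ruleDensity q.1 q.2.1 := by
    refine Continuous.mul ?_ continuous_ruleDensity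
    exact Continuous.mul (by fun_prop) (Continuous.div (by fun_prop) (by fun_prop)
      fun q => (mul_pos four_pos (delta_pos q.1)).ne')
  rw [← integral_cone_density, ← lintegral_ruled hJ measurableSet_Ioo Ioo_ae_eq_Ioc zero_le_one hJ0 (by fun_prop)]
  · refine setLIntegral_congr_fun (measurableSet_ruled measurableSet_Ioo 1) fun q hq => ?_
    simp only [det_jacRuledCone]
    rw [abs_of_nonneg]
    · rfl
    · exact hJ0 q.1 q.2.1 (Set.Ioo_subset_Icc_self hq.2.1) q.2.2 (Set.Ioc_subset_Icc_self hq.2.2)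
  · intro x
    have := delta_pos x
    positivity
  · intro x
    have hp := delta_pos x
    simp only [mul_assoc, intervalIntegral.integral_mul_const,
      intervalIntegral.integral_const_mul, integral_ruleDensity]
    simp
    field_simp
    ring
  · intro x; simp only [delta_neg]
  · intro x; simp only [delta_pi_sub]

lemma volume_arcExterior {ρ : ℝ} (hρ : 0 ≤ ρ) :
    MeasurableSet (shell ρ fun v => suppB v < suppA v) ∧
      volume (shell ρ fun v => suppB v < suppA v) =
        ENNReal.ofReal ((3 * π ^ 2 / 4 - 2 * constI) * ρ ^ 2 + 2 * π / 3 * ρ ^ 3) := by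
  have hπ := Real.pi_pos
  rw [shell_eq_arcExterior_image]
  have key := volume_image_eq_lintegral_det (measurableSet_arcDomain ρ)
    (fun q _ => hasFDerivAt_arcExterior q) (arcExterior_injOn ρ)
  refine ⟨key.1, key.2.trans ?_⟩
  set g : ℝ → ℝ := fun t => ρ ^ 2 / 2 * dualParam t + 2 / 3 * ρ ^ 3 * sin (dualParam t / 2) with hg
  have hT0 : ∀ t, 0 ≤ dualParam t := fun t => arccos_nonneg _
  have hcontT : ContinuousOn dualParam (Set.Icc (-(2 * π / 3)) (2 * π / 3)) :=
    continuousOn_dualParam.mono fun t ht => by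
      have : cos π < cos |t| :=
        cos_lt_cos_of_nonneg_of_le_pi (abs_nonneg t) le_rfl (by linarith [abs_le.2 ht])
      rw [cos_pi, cos_abs] at this
      rw [Set.mem_ofPred_eq]
      linarith
  have hcontS : ContinuousOn (fun t => sin (dualParam t / 2))
      (Set.Icc (-(2 * π / 3)) (2 * π / 3)) :=
    continuous_sin.comp_continuousOn (hcontT.div_const 2)
  have hgc : ContinuousOn g (Set.Icc (-(2 * π / 3)) (2 * π / 3)) :=
    (hcontT.const_mul _).add (hcontS.const_mul _)
  have hg0 : ∀ t, 0 ≤ g t := fun t => by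
    have h1 := hT0 t
    have h2 : 0 ≤ sin (dualParam t / 2) :=
      sin_nonneg_of_nonneg_of_le_pi (by linarith) (by linarith [dualParam_le_pi t])
    positivity
  have hcos : ∀ t, ∀ x ∈ Set.Icc (-(dualParam t / 2)) (dualParam t / 2), 0 ≤ cos x :=
    fun t x hx => cos_nonneg_of_mem_Icc
      ⟨by linarith [hx.1, dualParam_le_pi t], by linarith [hx.2, dualParam_le_pi t]⟩
  have hIg : ∫ t in (-(2 * π / 3))..(2 * π / 3), g t =
      (3 * π ^ 2 / 4 - 2 * constI) * ρ ^ 2 + 2 * π / 3 * ρ ^ 3 := by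
    have hsub : Set.uIcc 0 (2 * π / 3) ⊆ Set.Icc (-(2 * π / 3)) (2 * π / 3) := by
      rw [Set.uIcc_of_le (by positivity)]
      exact Set.Icc_subset_Icc_left (by linarith)
    have hsub' : Set.uIcc (-(2 * π / 3)) 0 ⊆ Set.Icc (-(2 * π / 3)) (2 * π / 3) := by
      rw [Set.uIcc_of_le (by linarith)]
      exact Set.Icc_subset_Icc_right (by positivity)
    have heven : ∫ t in (-(2 * π / 3))..0, g t = ∫ t in (0:ℝ)..(2 * π / 3), g t := by
      have := intervalIntegral.integral_comp_neg (a := 0) (b := 2 * π / 3) g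
      rw [neg_zero] at this
      rw [← this]
      simp [hg, dualParam]
    rw [← intervalIntegral.integral_add_adjacent_intervals (b := 0)
      (hgc.mono hsub').intervalIntegrable (hgc.mono hsub).intervalIntegrable, heven,
      intervalIntegral.integral_add ((hcontT.mono hsub).intervalIntegrable.const_mul _)
        ((hcontS.mono hsub).intervalIntegrable.const_mul _),
      intervalIntegral.integral_const_mul, intervalIntegral.integral_const_mul,
      integral_dualParam, integral_sin_dualParam]
    ring
  rw [← hIg]
  refine (setLIntegral_congr_fun (measurableSet_arcDomain ρ)
    (g := fun q => ENNReal.ofReal (q.2.2 * (1 + q.2.2 * cos q.2.1))) fun q hq => ?_).trans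
    (lintegral_eq_of_slices (measurableSet_arcDomain ρ) measurableSet_Ioo
      (S := fun t => Set.Ioo (-(dualParam t / 2)) (dualParam t / 2) ×ˢ Set.Ioc 0 ρ)
      (fun t r => ?_) (by fun_prop) (by linarith) Ioo_ae_eq_Ioc hgc (fun t _ => hg0 t)
      fun t _ => ?_)
  · have h1 := (arcDomain_facts hq).2.2.1
    have h2 := hq.2.2.1
    simp only [det_jacArcExterior]
    rw [abs_of_nonneg (by positivity)]
  · simp only [arcDomain, Set.mem_ofPred_eq, Set.mem_prod, abs_lt, Set.mem_Ioo]
  · rw [lintegral_prod_Ioc (K := fun r => r.2 * (1 + r.2 * cos r.1)) (by fun_prop)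
      (by linarith [hT0 t]) hρ Ioo_ae_eq_Ioc fun x hx y hy => ?_]
    · congr 1
      have hin : ∀ x, ∫ y in (0:ℝ)..ρ, y * (1 + y * cos x) =
          ρ ^ 2 / 2 + ρ ^ 3 / 3 * cos x := fun x => by
        have e : ∀ y, y * (1 + y * cos x) = y + y ^ 2 * cos x := fun y => by ring
        simp only [e]
        rw [intervalIntegral.integral_add (by simp)
          (Continuous.intervalIntegrable (by fun_prop) _ _), integral_id,
          intervalIntegral.integral_mul_const, integral_pow]
        norm_num
      simp only [hin]
      rw [intervalIntegral.integral_add (by simp)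
        (Continuous.intervalIntegrable (by fun_prop) _ _),
        intervalIntegral.integral_const_mul, integral_cos]
      simp [hg]
      ring
    · have := hcos t x hx
      have := hy.1
      positivity

lemma volume_coord_eq_zero (i : Fin 3) : volume {p : Space3 | p i = 0} = 0 := by
  refine Measure.addHaar_submodule volume
    (LinearMap.ker (EuclideanSpace.proj (𝕜 := ℝ) i : Space3 →L[ℝ] ℝ).toLinearMap) fun h => ?_
  have h1 : EuclideanSpace.single i (1:ℝ) ∈
      LinearMap.ker (EuclideanSpace.proj (𝕜 := ℝ) i : Space3 →L[ℝ] ℝ).toLinearMap :=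
    h ▸ Submodule.mem_top
  simp at h1

lemma volume_oloid :
    volume oloid =
      ENNReal.ofReal (2 / 3 * (2 * ellipticE (√3 / 2) + ellipticK (√3 / 2))) := by
  rw [← volume_ruledCone]
  refine le_antisymm ?_ (measure_mono ruledCone_image_subset)
  set C := ruledCone '' (Set.Ioc (-π) π ×ˢ Set.Ioo (0:ℝ) 1 ×ˢ Set.Ioc (0:ℝ) 1)
  have hsub : oloid ⊆ C ∪ ({p : Space3 | p 0 = 0} ∪ {p : Space3 | p 2 = 0}) := fun p hp => by
    by_cases h0 : p 0 = 0
    · exact Or.inr (Or.inl h0)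
    · by_cases h2 : p 2 = 0
      · exact Or.inr (Or.inr h2)
      · exact Or.inl (mem_ruledCone_image hp h0 h2)
  calc volume oloid ≤ _ := measure_mono hsub
    _ ≤ volume C + (volume {p : Space3 | p 0 = 0} + volume {p : Space3 | p 2 = 0}) :=
      (measure_union_le _ _).trans (by gcongr; exact measure_union_le _ _)
    _ = volume C := by simp only [volume_coord_eq_zero, add_zero]

lemma volume_shell_lt (ρ : ℝ) :
    volume (shell ρ fun v => suppA v < suppB v) = volume (shell ρ fun v => suppB v < suppA v) := by
  rw [shell_lt_eq_image, ← swapAB.measurePreserving.measure_preimage_emb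
    swapAB.toHomeomorph.measurableEmbedding, Set.preimage_image_eq _ swapAB.injective]

lemma volume_oloid_add_closedBall {ρ : ℝ} (hρ : 0 ≤ ρ) :
    volume (oloid + Metric.closedBall (0 : Space3) ρ) = ENNReal.ofReal
      (2 / 3 * (2 * ellipticE (√3 / 2) + ellipticK (√3 / 2)) + 4 * π * ρ +
        (3 * ellipticK (√3 / 2) + 3 * π ^ 2 / 2 - 4 * constI) * ρ ^ 2 + 4 * π / 3 * ρ ^ 3) := by
  have hA := volume_arcExterior hρ
  have hR := volume_ruledExterior hρ
  have hmB : MeasurableSet (shell ρ fun v => suppA v < suppB v) := by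
    rw [shell_lt_eq_image]
    exact swapAB.toHomeomorph.measurableEmbedding.measurableSet_image.2 hA.1
  have hK : 0 ≤ ellipticK (√3 / 2) := by
    rw [ellipticK_eq]
    exact intervalIntegral.integral_nonneg (by positivity) fun x _ => by
      have := delta_pos x
      positivity
  have hE : 0 ≤ ellipticE (√3 / 2) := by
    rw [ellipticE_eq]
    exact intervalIntegral.integral_nonneg (by positivity) fun x _ => (delta_pos x).le
  have hI : 0 ≤ 3 * π ^ 2 / 4 - 2 * constI := by
    rw [← integral_dualParam]
    exact intervalIntegral.integral_nonneg (by positivity) fun x _ => arccos_nonneg _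
  rw [parallelBody_eq_union hρ, measure_union _ (hmB.union hR.1 |> hA.1.union),
    measure_union _ (hmB.union hR.1), measure_union _ hR.1, volume_shell_lt, hA.2, hR.2,
    volume_oloid, ← ENNReal.ofReal_add (by positivity) (by positivity),
    ← ENNReal.ofReal_add (by positivity) (by positivity),
    ← ENNReal.ofReal_add (by positivity) (by positivity)]
  · congr 1
    ring
  · exact disjoint_shell fun v h => h.ne
  · exact Set.disjoint_union_right.2
      ⟨disjoint_shell fun v h => h.not_gt, disjoint_shell fun v h => h.ne'⟩
  · simp only [Set.disjoint_union_right]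
    exact ⟨disjoint_oloid_shell _ _, disjoint_oloid_shell _ _, disjoint_oloid_shell _ _⟩

/-- The volume of the parallel body `Ω_{r,ρ} = Ω_r + B̄(0,ρ)` equals
`(2/3)[2E(√3/2) + K(√3/2)]·r³ + 4π·r²ρ + M₁·rρ² + (4π/3)·ρ³`,
where `M₁ = 3K(√3/2) + 3π²/2 − 4I`. -/
theorem volume_parallelBody (r ρ : ℝ) (hr : 0 < r) (hρ : 0 < ρ) :
    volume (oloidR r + Metric.closedBall (0 : EuclideanSpace ℝ (Fin 3)) ρ) =
      ENNReal.ofReal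
        ((2 / 3) * (2 * ellipticE (Real.sqrt 3 / 2) + ellipticK (Real.sqrt 3 / 2)) * r ^ 3
          + 4 * π * r ^ 2 * ρ
          + (3 * ellipticK (Real.sqrt 3 / 2) + 3 * π ^ 2 / 2 - 4 * constI) * r * ρ ^ 2
          + (4 * π / 3) * ρ ^ 3) := by
  have hball : Metric.closedBall (0 : Space3) ρ = r • Metric.closedBall (0 : Space3) (ρ / r) := by
    rw [smul_closedBall' hr.ne', smul_zero, Real.norm_of_nonneg hr.le, mul_div_cancel₀ _ hr.ne']
  rw [oloidR, hball, ← smul_add, Measure.addHaar_smul, finrank_euclideanSpace_fin,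
    volume_oloid_add_closedBall (by positivity), abs_of_pos (by positivity),
    ← ENNReal.ofReal_mul (by positivity)]
  congr 1
  field_simp
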